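/- Let k be a perfect field of characteristic p ≥ 0, d ≥ 1, and k[z₁, …, z_{d-1}] → R an étale ring homomorphism (for d = 1, R is étale over k). Let A = R[z], and in A⊗_k A set t = z⊗1, s = 1⊗z, t_i = z_i⊗1, s_i = 1⊗z_i, θ_i = s_i − t_i. Let S ⊆ A⊗_k A be a multiplicative set with μ(S) ⊆ A^×, B = S^{-1}(A⊗_k A), and assume the diagonal ideal of B is generated by the regular sequence s−t, θ₁, …, θ_{d-1}. For n ≥ 1 let C = B[τ, τ₁, …, τ_{d-1}][(1+t^{n-1}τ)^{-1}]/(s − t − t^n τ, θ₁ − t^n τ₁, …, θ_{d-1} − t^n τ_{d-1}). Let j ≥ 1, q, r ≥ 1, α₁, …, α_q ∈ Ω^{j-1}_R with α_q ≠ 0, and β₁, …, β_r ∈ Ω^j_R with β_r ≠ 0, and set φ = Σ_{i=1}^q ι(α_i) ∧ (z^{-i} dz) + Σ_{i=1}^r z^{-i}·ι(β_i) ∈ Ω^j_{A[1/z]}, where ι is induced by R → A[1/z]. Then p₂^*(φ) − p₁^*(φ) ∈ Ω^j_{C[1/t]} lies in the image of the canonical map Ω^j_C → Ω^j_{C[1/t]}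 if and only if: (q ≤ n and r ≤ n−1) in case p = 0 or p does not divide n; and (q ≤ n and r ≤ n) in case p > 0 and p divides n. -/

import Mathlib

set_option maxHeartbeats 1000000
set_option synthInstance.maxHeartbeats 400000

open TensorProduct

noncomputable section

variable (k : Type) [Field k]

/-- The element `d s` of the exterior algebra `⋀_S Ω¹_{S/k}` of Kähler differentials,
i.e. the universal derivation followed by the degree-one inclusion. -/
def dE (S : Type) [CommRing S] [Algebra k S] (s : S) :
    ExteriorAlgebra S (KaehlerDifferential k S) :=
  ExteriorAlgebra.ι S (KaehlerDifferential.D k S s)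

/-- `Ω^j_{S/k}`, realized as the degree-`j` component of the exterior algebra of
`Ω¹_{S/k}`, i.e. the `j`-th power of the image of `Ω¹` in the exterior algebra. -/
def OmegaPow (S : Type) [CommRing S] [Algebra k S] (j : ℕ) :
    Submodule S (ExteriorAlgebra S (KaehlerDifferential k S)) :=
  (LinearMap.range (ExteriorAlgebra.ι S :
    KaehlerDifferential k S →ₗ[S] ExteriorAlgebra S (KaehlerDifferential k S))) ^ j

/-- `J^j`, the degree `j` part of the differential graded ideal of `Ω^•_{S/k}` generated
by an ideal `I ⊆ S`:  `J^0 = I` (inside `Ω^0 = S`), and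
`J^j = I·Ω^j + dI ∧ Ω^{j-1}` for `j ≥ 1`. -/
def Jdeg (S : Type) [CommRing S] [Algebra k S] (I : Ideal S) :
    ℕ → Submodule S (ExteriorAlgebra S (KaehlerDifferential k S))
  | 0 => I • OmegaPow k S 0
  | j + 1 =>
      I • OmegaPow k S (j + 1) ⊔
        Submodule.span S
          {x | ∃ θ ∈ I, ∃ ε ∈ OmegaPow k S j, x = dE k S θ * ε}

/-- `(J·J)^j = Σ_{a+b=j} J^a ∧ J^b`, the degree `j` part of the square of the differential
graded ideal generated by `I`. -/
def JJdeg (S : Type) [CommRing S] [Algebra k S] (I : Ideal S) (j : ℕ) :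
    Submodule S (ExteriorAlgebra S (KaehlerDifferential k S)) :=
  ⨆ p : {p : ℕ × ℕ // p.1 + p.2 = j},
    Submodule.span S
      {x | ∃ y ∈ Jdeg k S I p.1.1, ∃ z ∈ Jdeg k S I p.1.2, x = y * z}

/-- `P` is the map `Ω^•_{S/k} → Ω^•_{T/k}` of exterior algebras of differential forms
induced by a ring homomorphism `φ : S → T` (of `k`-algebras): it is a ring homomorphism
satisfying `P(s·1) = φ(s)·1` on scalars and `P(ds) = d(φ s)` on exact one-forms.  These
two conditions determine `P` uniquely, since the exterior algebra is generated as a ring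
by the scalars and the exact one-forms. -/
def IsPullback (S T : Type) [CommRing S] [CommRing T] [Algebra k S] [Algebra k T]
    (φ : S →+* T)
    (P : ExteriorAlgebra S (KaehlerDifferential k S) →+*
      ExteriorAlgebra T (KaehlerDifferential k T)) : Prop :=
  (∀ s : S, P (algebraMap S (ExteriorAlgebra S (KaehlerDifferential k S)) s) =
    algebraMap T (ExteriorAlgebra T (KaehlerDifferential k T)) (φ s)) ∧
  (∀ s : S, P (dE k S s) = dE k T (φ s))

/-- `θ 0, θ 1, …, θ (d-1)` is a regular sequence in `B`: each `θ i` is a nonzerodivisor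
modulo the ideal generated by the previous ones. -/
def IsRegSeq {B : Type*} [CommRing B] {d : ℕ} (θ : Fin d → B) : Prop :=
  ∀ i : Fin d, ∀ b : B,
    θ i * b ∈ Ideal.span (θ '' {j : Fin d | j < i}) →
      b ∈ Ideal.span (θ '' {j : Fin d | j < i})

section Dilatation

variable (e : ℕ) (R : Type) [CommRing R] [Algebra k R]

/-- `A = R[z]`. -/
abbrev PolyA : Type := Polynomial R

/-- `t = z⊗1 ∈ A ⊗_k A`. -/
def tElt : PolyA R ⊗[k] PolyA R := (Polynomial.X : PolyA R) ⊗ₜ[k] (1 : PolyA R)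

/-- `s = 1⊗z ∈ A ⊗_k A`. -/
def sElt : PolyA R ⊗[k] PolyA R := (1 : PolyA R) ⊗ₜ[k] (Polynomial.X : PolyA R)

variable [Algebra (MvPolynomial (Fin e) k) R]

/-- `z_i ∈ A`, the image of the `i`-th polynomial variable of `k[z₁,…,z_{d-1}]` in
`R ⊆ A = R[z]`. -/
def zElt (i : Fin e) : PolyA R :=
  Polynomial.C (algebraMap (MvPolynomial (Fin e) k) R (MvPolynomial.X i))

/-- `θ_i = s_i − t_i = 1⊗z_i − z_i⊗1 ∈ A ⊗_k A`. -/
def θElt (i : Fin e) : PolyA R ⊗[k] PolyA R :=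
  (1 : PolyA R) ⊗ₜ[k] zElt k e R i - zElt k e R i ⊗ₜ[k] (1 : PolyA R)

variable (n : ℕ) (B : Type) [CommRing B] [Algebra (PolyA R ⊗[k] PolyA R) B]

/-- `t` viewed in the localization `B` of `A ⊗_k A`. -/
def tB : B := algebraMap (PolyA R ⊗[k] PolyA R) B (tElt k R)

/-- The localization of `B[τ, τ₁, …, τ_{d-1}]` at `1 + t^{n-1}·τ` (variable `0` is `τ`,
variable `i.succ` is `τ_i`). -/
abbrev Lloc : Type :=
  Localization.Away
    ((1 : MvPolynomial (Fin (e + 1)) B) +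
      MvPolynomial.C (tB k R B ^ (n - 1)) * MvPolynomial.X 0)

/-- The relations `s − t − t^n·τ` and `θ_i − t^n·τ_i`, `i = 1, …, d-1`. -/
def relIdeal : Ideal (Lloc k e R n B) :=
  Ideal.span
    ({algebraMap (MvPolynomial (Fin (e + 1)) B) (Lloc k e R n B)
        (MvPolynomial.C (algebraMap (PolyA R ⊗[k] PolyA R) B (sElt k R - tElt k R)) -
          MvPolynomial.X 0 * MvPolynomial.C (tB k R B ^ n))} ∪
      {y | ∃ i : Fin e,
        y = algebraMap (MvPolynomial (Fin (e + 1)) B) (Lloc k e R n B)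
          (MvPolynomial.C (algebraMap (PolyA R ⊗[k] PolyA R) B (θElt k e R i)) -
            MvPolynomial.X i.succ * MvPolynomial.C (tB k R B ^ n))})

/-- The ring
`C = B[τ, τ₁,…,τ_{d-1}][(1+t^{n-1}τ)^{-1}]/(s−t−t^nτ, θ₁−t^nτ₁, …, θ_{d-1}−t^nτ_{d-1})`. -/
abbrev Cdil : Type := Lloc k e R n B ⧸ relIdeal k e R n B

/-- The image of `t` in `C`. -/
def tC : Cdil k e R n B :=
  Ideal.Quotient.mk (relIdeal k e R n B)
    (algebraMap (MvPolynomial (Fin (e + 1)) B) (Lloc k e R n B)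
      (MvPolynomial.C (tB k R B)))

/-- The canonical ring homomorphism `A ⊗_k A → C[1/t]`, for `Ct` a localization of `C`
away from the image of `t`. -/
def canTA (Ct : Type) [CommRing Ct] [Algebra (Cdil k e R n B) Ct] :
    PolyA R ⊗[k] PolyA R →+* Ct :=
  (algebraMap (Cdil k e R n B) Ct).comp
    ((Ideal.Quotient.mk (relIdeal k e R n B)).comp
      ((algebraMap (MvPolynomial (Fin (e + 1)) B) (Lloc k e R n B)).comp
        ((algebraMap B (MvPolynomial (Fin (e + 1)) B)).comp
          (algebraMap (PolyA R ⊗[k] PolyA R) B))))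

end Dilatation

section DilatationMaps

variable (e : ℕ) (R : Type) [CommRing R] [Algebra k R]
  [Algebra (MvPolynomial (Fin e) k) R]
  (n : ℕ) (B : Type) [CommRing B] [Algebra (PolyA R ⊗[k] PolyA R) B]

/-- The canonical map from `B[τ, τ₁, …]` to its dilatation quotient `C`. -/
def mvToCdil : MvPolynomial (Fin (e + 1)) B →+* Cdil k e R n B :=
  (Ideal.Quotient.mk (relIdeal k e R n B)).comp
    (algebraMap (MvPolynomial (Fin (e + 1)) B) (Lloc k e R n B))

/-- The canonical map `A ⊗_k A → C`. -/
def tensorToCdil : PolyA R ⊗[k] PolyA R →+* Cdil k e R n B :=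
  (mvToCdil k e R n B).comp
    ((algebraMap B (MvPolynomial (Fin (e + 1)) B)).comp
      (algebraMap (PolyA R ⊗[k] PolyA R) B))

theorem canTA_eq (Ct : Type) [CommRing Ct] [Algebra (Cdil k e R n B) Ct]
    (x : PolyA R ⊗[k] PolyA R) :
    canTA k e R n B Ct x = algebraMap (Cdil k e R n B) Ct (tensorToCdil k e R n B x) := rfl

theorem tC_eq : tC k e R n B = tensorToCdil k e R n B (tElt k R) := rfl

theorem tensorToCdil_C (b : PolyA R ⊗[k] PolyA R) :
    tensorToCdil k e R n B b =
      mvToCdil k e R n B (MvPolynomial.C (algebraMap _ B b)) := rfl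

theorem algebraMap_Cdil_eq [Algebra k B] [IsScalarTower k (PolyA R ⊗[k] PolyA R) B] (c : k) :
    algebraMap k (Cdil k e R n B) c =
      tensorToCdil k e R n B (algebraMap k (PolyA R) c ⊗ₜ[k] (1 : PolyA R)) := by
  have h1 : algebraMap k (PolyA R) c ⊗ₜ[k] (1 : PolyA R) =
      algebraMap k (PolyA R ⊗[k] PolyA R) c := rfl
  rw [h1, tensorToCdil_C, ← IsScalarTower.algebraMap_apply]
  rfl

theorem mvToCdil_C_tB_pow (m : ℕ) :
    mvToCdil k e R n B (MvPolynomial.C (tB k R B ^ m)) = tC k e R n B ^ m :=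
  map_pow ((mvToCdil k e R n B).comp MvPolynomial.C) (tB k R B) m

theorem mvToCdil_rel_zero :
    mvToCdil k e R n B (MvPolynomial.C (algebraMap _ B (sElt k R - tElt k R))) =
      mvToCdil k e R n B (MvPolynomial.X 0) * tC k e R n B ^ n := by
  have h : (Ideal.Quotient.mk (relIdeal k e R n B))
      (algebraMap (MvPolynomial (Fin (e + 1)) B) (Lloc k e R n B)
        (MvPolynomial.C (algebraMap (PolyA R ⊗[k] PolyA R) B (sElt k R - tElt k R)) -
          MvPolynomial.X 0 * MvPolynomial.C (tB k R B ^ n))) = 0 :=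
    Ideal.Quotient.eq_zero_iff_mem.2 (Ideal.subset_span (Or.inl rfl))
  change mvToCdil k e R n B _ = 0 at h
  rw [map_sub, sub_eq_zero, map_mul, mvToCdil_C_tB_pow] at h
  exact h

theorem mvToCdil_rel_succ (i : Fin e) :
    mvToCdil k e R n B (MvPolynomial.C (algebraMap _ B (θElt k e R i))) =
      mvToCdil k e R n B (MvPolynomial.X i.succ) * tC k e R n B ^ n := by
  have h : (Ideal.Quotient.mk (relIdeal k e R n B))
      (algebraMap (MvPolynomial (Fin (e + 1)) B) (Lloc k e R n B)
        (MvPolynomial.C (algebraMap (PolyA R ⊗[k] PolyA R) B (θElt k e R i)) -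
          MvPolynomial.X i.succ * MvPolynomial.C (tB k R B ^ n))) = 0 :=
    Ideal.Quotient.eq_zero_iff_mem.2 (Ideal.subset_span (Or.inr ⟨i, rfl⟩))
  change mvToCdil k e R n B _ = 0 at h
  rw [map_sub, sub_eq_zero, map_mul, mvToCdil_C_tB_pow] at h
  exact h

theorem isUnit_one_add_tau :
    IsUnit (1 + tC k e R n B ^ (n - 1) * mvToCdil k e R n B (MvPolynomial.X 0)) := by
  have h : IsUnit (algebraMap (MvPolynomial (Fin (e + 1)) B) (Lloc k e R n B)
      ((1 : MvPolynomial (Fin (e + 1)) B) +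
      MvPolynomial.C (tB k R B ^ (n - 1)) * MvPolynomial.X 0)) :=
    IsLocalization.Away.algebraMap_isUnit _
  have h2 := h.map (Ideal.Quotient.mk (relIdeal k e R n B))
  change IsUnit (mvToCdil k e R n B _) at h2
  rw [map_add, map_one, map_mul, mvToCdil_C_tB_pow] at h2
  exact h2

variable {k e R n B}

/-- Maps out of the dilatation ring `C` into a nilpotent-like thickening `V` of `A`: it suffices
to give the two maps `A → V` and values of `τ, τ₁, …` satisfying the relations. -/
theorem exists_ringHom_Cdil [Algebra k B] [IsScalarTower k (PolyA R ⊗[k] PolyA R) B]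
    (M : Submonoid (PolyA R ⊗[k] PolyA R))
    (hM : ∀ x ∈ M,
      IsUnit ((Algebra.TensorProduct.lmul' k (S := PolyA R) :
        PolyA R ⊗[k] PolyA R →ₐ[k] PolyA R) x)) [IsLocalization M B]
    {V : Type} [CommRing V] (g₁ g₂ : PolyA R →+* V)
    (hk : ∀ c : k, g₂ (algebraMap k (PolyA R) c) = g₁ (algebraMap k (PolyA R) c))
    (π : V →+* PolyA R) [IsLocalHom π]
    (hπ₁ : ∀ a, π (g₁ a) = a) (hπ₂ : ∀ a, π (g₂ a) = a)
    (τ : Fin (e + 1) → V) (hτ : π (τ 0) = 0)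
    (h0 : g₂ Polynomial.X - g₁ Polynomial.X = τ 0 * g₁ Polynomial.X ^ n)
    (hs : ∀ i, g₂ (zElt k e R i) - g₁ (zElt k e R i) = τ i.succ * g₁ Polynomial.X ^ n) :
    ∃ h : Cdil k e R n B →+* V,
      (∀ a, h (tensorToCdil k e R n B (a ⊗ₜ[k] (1 : PolyA R))) = g₁ a) ∧
      (∀ a, h (tensorToCdil k e R n B ((1 : PolyA R) ⊗ₜ[k] a)) = g₂ a) := by
  let _ : Algebra k V := (g₁.comp (algebraMap k (PolyA R))).toAlgebra
  let G₁ : PolyA R →ₐ[k] V := { g₁ with commutes' := fun c => rfl }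
  let G₂ : PolyA R →ₐ[k] V := { g₂ with commutes' := fun c => hk c }
  let g : PolyA R ⊗[k] PolyA R →ₐ[k] V :=
    Algebra.TensorProduct.lift G₁ G₂ (fun _ _ => Commute.all _ _)
  have hg1 : ∀ a, g (a ⊗ₜ[k] (1 : PolyA R)) = g₁ a := fun a => by
    simp [g, Algebra.TensorProduct.lift_tmul, G₁]
  have hg2 : ∀ a, g ((1 : PolyA R) ⊗ₜ[k] a) = g₂ a := fun a => by
    simp [g, Algebra.TensorProduct.lift_tmul, G₂]
  have hπg : ∀ x, π (g x) = Algebra.TensorProduct.lmul' k (S := PolyA R) x := fun x => by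
    induction x with
    | zero => simp
    | add x y hx hy => simp [hx, hy]
    | tmul a b =>
      have : a ⊗ₜ[k] b = (a ⊗ₜ[k] (1 : PolyA R)) * ((1 : PolyA R) ⊗ₜ[k] b) := by simp
      rw [this, map_mul, map_mul, hg1, hg2, hπ₁, hπ₂]
      simp
  have hunit : ∀ y : M, IsUnit ((g : PolyA R ⊗[k] PolyA R →+* V) y) := fun y => by
    have := hM y y.2
    rw [← hπg] at this
    exact isUnit_of_map_unit π _ this
  let gB : B →+* V := IsLocalization.lift (M := M) hunit
  have hgB : ∀ x, gB (algebraMap _ B x) = g x := fun x => IsLocalization.lift_eq hunit x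
  let gM : MvPolynomial (Fin (e + 1)) B →+* V := MvPolynomial.eval₂Hom gB τ
  have hgt : gB (tB k R B) = g₁ Polynomial.X := by rw [tB, hgB, tElt, hg1]
  have hu : IsUnit (gM ((1 : MvPolynomial (Fin (e + 1)) B) +
      MvPolynomial.C (tB k R B ^ (n - 1)) * MvPolynomial.X 0)) := by
    apply isUnit_of_map_unit π
    simp [gM, hτ]
  let gL : Lloc k e R n B →+* V := IsLocalization.Away.lift _ hu
  have hgL : ∀ x, gL (algebraMap _ _ x) = gM x := fun x => IsLocalization.Away.lift_eq _ hu x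
  have hrel : ∀ x ∈ relIdeal k e R n B, gL x = 0 := by
    intro x hx
    have : relIdeal k e R n B ≤ RingHom.ker gL := by
      refine Ideal.span_le.2 ?_
      rintro _ (rfl | ⟨i, rfl⟩)
      · rw [SetLike.mem_coe, RingHom.mem_ker, hgL]
        simp only [gM, map_sub, map_mul, map_pow, MvPolynomial.coe_eval₂Hom,
          MvPolynomial.eval₂_C, MvPolynomial.eval₂_X, hgt, hgB, sElt, tElt, hg1, hg2, h0,
          sub_self]
      · rw [SetLike.mem_coe, RingHom.mem_ker, hgL]
        simp only [gM, map_sub, map_mul, map_pow, MvPolynomial.coe_eval₂Hom,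
          MvPolynomial.eval₂_C, MvPolynomial.eval₂_X, hgt, hgB, θElt, hg1, hg2, hs,
          sub_self]
    exact this hx
  refine ⟨Ideal.Quotient.lift _ gL hrel, fun a => ?_, fun a => ?_⟩
  · change gL (algebraMap _ _ _) = _
    rw [hgL]
    simp [gM, hgB, hg1]
  · change gL (algebraMap _ _ _) = _
    rw [hgL]
    simp [gM, hgB, hg2]

end DilatationMaps

section Forms

variable {k}

theorem kaehler_induction {S : Type} [CommRing S] [Algebra k S]
    {P : KaehlerDifferential k S → Prop} (hz : P 0) (hD : ∀ s, P (KaehlerDifferential.D k S s))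
    (hadd : ∀ x y, P x → P y → P (x + y)) (hsmul : ∀ (s : S) x, P x → P (s • x)) (x) : P x := by
  have hx : x ∈ Submodule.span S (Set.range (KaehlerDifferential.D k S)) := by
    rw [KaehlerDifferential.span_range_derivation]; trivial
  induction hx using Submodule.span_induction with
  | mem x h => obtain ⟨s, rfl⟩ := h; exact hD s
  | zero => exact hz
  | add x y _ _ hx hy => exact hadd x y hx hy
  | smul s x _ hx => exact hsmul s x hx

/-- Induction principle for the algebra of differential forms: it is generated by scalars and
exact one-forms. -/
theorem forms_induction {S : Type} [CommRing S] [Algebra k S]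
    {P : ExteriorAlgebra S (KaehlerDifferential k S) → Prop}
    (hs : ∀ s : S, P (algebraMap S _ s)) (hD : ∀ s : S, P (dE k S s))
    (hadd : ∀ x y, P x → P y → P (x + y)) (hmul : ∀ x y, P x → P y → P (x * y)) (x) : P x := by
  induction x using ExteriorAlgebra.induction with
  | algebraMap r => exact hs r
  | ι m =>
    induction m using kaehler_induction with
    | hz => simpa using hs 0
    | hD s => exact hD s
    | hadd x y hx hy => rw [map_add]; exact hadd _ _ hx hy
    | hsmul s x hx => rw [map_smul, Algebra.smul_def]; exact hmul _ _ (hs s) hx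
  | mul a b ha hb => exact hmul a b ha hb
  | add a b ha hb => exact hadd a b ha hb

/-- Ring homomorphisms out of the algebra of differential forms are determined by their values on
scalars and exact one-forms. -/
theorem forms_hom_ext {S E : Type} [CommRing S] [Algebra k S] [Ring E]
    {F G : ExteriorAlgebra S (KaehlerDifferential k S) →+* E}
    (hs : ∀ s : S, F (algebraMap S _ s) = G (algebraMap S _ s))
    (hD : ∀ s : S, F (dE k S s) = G (dE k S s)) (x) : F x = G x := by
  induction x using forms_induction with
  | hs s => exact hs s
  | hD s => exact hD s
  | hadd x y hx hy => rw [map_add, map_add, hx, hy]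
  | hmul x y hx hy => rw [map_mul, map_mul, hx, hy]

/-- A central ring homomorphism together with a derivation whose values square to zero induces a
ring homomorphism out of the algebra of differential forms. -/
theorem exists_forms_hom {S E : Type} [CommRing S] [Algebra k S] [Ring E]
    (f : S →+* E) (hf : ∀ s x, f s * x = x * f s) (δ : S →+ E)
    (hmul : ∀ a b, δ (a * b) = f a * δ b + f b * δ a)
    (hk : ∀ c : k, δ (algebraMap k S c) = 0) (hsq : ∀ a, δ a * δ a = 0) :
    ∃ F : ExteriorAlgebra S (KaehlerDifferential k S) →+* E,
      (∀ s : S, F (algebraMap S _ s) = f s) ∧ ∀ s : S, F (dE k S s) = δ s := by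
  let _ : Algebra S E := f.toAlgebra' hf
  let _ : Algebra k E := (f.comp (algebraMap k S)).toAlgebra' (fun c x => hf _ _)
  have _ : IsScalarTower k S E := IsScalarTower.of_algebraMap_eq (fun c => rfl)
  have smul_eq : ∀ (s : S) (x : E), s • x = f s * x := fun s x => rfl
  have smul_eq' : ∀ (c : k) (x : E), c • x = f (algebraMap k S c) * x := fun s x => rfl
  let D : Derivation k S E := Derivation.mk'
    { toFun := δ, map_add' := map_add δ, map_smul' := fun c x => by
        rw [Algebra.smul_def, hmul, hk, mul_zero, add_zero]; rfl }
    (fun a b => hmul a b)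
  have hDδ : ∀ s, D s = δ s := fun s => rfl
  have hL : ∀ s, D.liftKaehlerDifferential (KaehlerDifferential.D k S s) = δ s := fun s => by
    rw [Derivation.liftKaehlerDifferential_comp_D, hDδ]
  have anti1 : ∀ a b, δ a * δ b + δ b * δ a = 0 := fun a b => by
    have := hsq (a + b)
    rw [map_add, mul_add, add_mul, add_mul, hsq, hsq, zero_add, add_zero, add_comm] at this
    exact this
  have anti2 : ∀ x b, D.liftKaehlerDifferential x * δ b + δ b * D.liftKaehlerDifferential x = 0 := by
    intro x b
    induction x using kaehler_induction with
    | hz => simp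
    | hD s => rw [hL]; exact anti1 _ _
    | hadd x y hx hy =>
      rw [map_add, add_mul, mul_add, add_add_add_comm, hx, hy, add_zero]
    | hsmul s x hx =>
      rw [map_smul, smul_mul_assoc, mul_smul_comm, ← smul_add, hx, smul_zero]
  have anti3 : ∀ x y, D.liftKaehlerDifferential x * D.liftKaehlerDifferential y +
      D.liftKaehlerDifferential y * D.liftKaehlerDifferential x = 0 := by
    intro x y
    induction y using kaehler_induction with
    | hz => simp
    | hD s => rw [hL]; exact anti2 _ _
    | hadd y z hx hy =>
      rw [map_add, add_mul, mul_add, add_add_add_comm, hx, hy, add_zero]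
    | hsmul s y hx =>
      rw [map_smul, smul_mul_assoc, mul_smul_comm, ← smul_add, hx, smul_zero]
  have hsq' : ∀ x, D.liftKaehlerDifferential x * D.liftKaehlerDifferential x = 0 := by
    intro x
    induction x using kaehler_induction with
    | hz => simp
    | hD s => rw [hL]; exact hsq _
    | hadd x y hx hy =>
      rw [map_add, add_mul, mul_add, mul_add, hx, hy, zero_add, add_zero]; exact anti3 _ _
    | hsmul s y hx =>
      rw [map_smul, smul_mul_assoc, mul_smul_comm, hx, smul_zero, smul_zero]
  refine ⟨(ExteriorAlgebra.lift S ⟨D.liftKaehlerDifferential, hsq'⟩ : _ →ₐ[S] E), fun s => ?_,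
    fun s => ?_⟩
  · exact AlgHom.commutes _ s
  · change ExteriorAlgebra.lift S ⟨D.liftKaehlerDifferential, hsq'⟩ (ExteriorAlgebra.ι S _) = _
    rw [ExteriorAlgebra.lift_ι_apply]
    exact hL s

/-- Graded commutativity of a one-form against an arbitrary form. -/
theorem exists_mul_ι_comm {S N : Type} [CommRing S] [AddCommGroup N] [Module S N] (v : N)
    (x : ExteriorAlgebra S N) :
    ∃ y, x * ExteriorAlgebra.ι S v = ExteriorAlgebra.ι S v * y := by
  induction x using ExteriorAlgebra.induction with
  | algebraMap r => exact ⟨algebraMap _ _ r, Algebra.commutes _ _⟩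
  | ι w =>
    refine ⟨-ExteriorAlgebra.ι S w, ?_⟩
    rw [mul_neg, eq_neg_iff_add_eq_zero, ExteriorAlgebra.ι_add_mul_swap]
  | mul a b ha hb =>
    obtain ⟨a', ha⟩ := ha
    obtain ⟨b', hb⟩ := hb
    exact ⟨a' * b', by rw [mul_assoc, hb, ← mul_assoc, ha, mul_assoc]⟩
  | add a b ha hb =>
    obtain ⟨a', ha⟩ := ha
    obtain ⟨b', hb⟩ := hb
    exact ⟨a' + b', by rw [add_mul, ha, hb, mul_add]⟩

theorem dE_mul (S : Type) [CommRing S] [Algebra k S] (a b : S) :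
    dE k S (a * b) = a • dE k S b + b • dE k S a := by
  simp [dE]

theorem dE_add (S : Type) [CommRing S] [Algebra k S] (a b : S) :
    dE k S (a + b) = dE k S a + dE k S b := by
  simp [dE]

theorem dE_pow (S : Type) [CommRing S] [Algebra k S] (a : S) (n : ℕ) :
    dE k S (a ^ n) = ((n : S) * a ^ (n - 1)) • dE k S a := by
  rw [dE, Derivation.leibniz_pow, ← Nat.cast_smul_eq_nsmul S n, smul_smul, map_smul, dE]

theorem IsPullback.map_OmegaPow {S T : Type} [CommRing S] [CommRing T] [Algebra k S] [Algebra k T]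
    {φ : S →+* T} {P} (hP : IsPullback k S T φ P) {j : ℕ}
    {x : ExteriorAlgebra S (KaehlerDifferential k S)} (hx : x ∈ OmegaPow k S j) :
    P x ∈ OmegaPow k T j := by
  induction hx using Submodule.pow_induction_on_left' with
  | algebraMap r =>
    rw [hP.1, OmegaPow, pow_zero]; exact Submodule.algebraMap_mem _
  | add x y i hx hy ihx ihy => rw [map_add]; exact add_mem ihx ihy
  | mem_mul m hm i x hx ih =>
    rw [map_mul, OmegaPow, pow_succ']
    refine Submodule.mul_mem_mul ?_ ih
    obtain ⟨v, rfl⟩ := hm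
    induction v using kaehler_induction with
    | hz => simp
    | hD s => exact hP.2 s ▸ LinearMap.mem_range_self _ _
    | hadd x y hx hy => rw [map_add, map_add]; exact add_mem hx hy
    | hsmul s x hx =>
      rw [map_smul, Algebra.smul_def, map_mul, hP.1, ← Algebra.smul_def]
      exact Submodule.smul_mem _ _ hx

theorem mul_dE_mem_OmegaPow {S : Type} [CommRing S] [Algebra k S] {j : ℕ} {x}
    (hx : x ∈ OmegaPow k S j) (s : S) : x * dE k S s ∈ OmegaPow k S (j + 1) := by
  rw [OmegaPow, pow_succ]
  exact Submodule.mul_mem_mul hx (LinearMap.mem_range_self _ _)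

/-- If a form of degree `j` is a pullback of some form, then it is a pullback of a form of degree
`j`. -/
theorem IsPullback.exists_mem_OmegaPow {S T : Type} [CommRing S] [CommRing T] [Algebra k S]
    [Algebra k T] {φ : S →+* T} {P} (hP : IsPullback k S T φ P) {j : ℕ}
    {x : ExteriorAlgebra S (KaehlerDifferential k S)} (hx : P x ∈ OmegaPow k T j) :
    ∃ y ∈ OmegaPow k S j, P y = P x := by
  classical
  let 𝒮 : ℕ → Submodule S (ExteriorAlgebra S (KaehlerDifferential k S)) := fun i =>
    ⋀[S]^i (KaehlerDifferential k S)
  let 𝒯 : ℕ → Submodule T (ExteriorAlgebra T (KaehlerDifferential k T)) := fun i =>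
    ⋀[T]^i (KaehlerDifferential k T)
  have key : ∀ x, P (DirectSum.decompose 𝒮 x j) = DirectSum.decompose 𝒯 (P x) j := by
    intro x
    induction x using DirectSum.Decomposition.inductionOn 𝒮 with
    | zero => simp
    | add x y hx hy => simp [DirectSum.decompose_add, hx, hy]
    | @homogeneous i m =>
      have hm : P m ∈ 𝒯 i := hP.map_OmegaPow m.2
      by_cases h : i = j
      · subst h
        rw [DirectSum.decompose_of_mem_same 𝒮 m.2, DirectSum.decompose_of_mem_same 𝒯 hm]
      · rw [DirectSum.decompose_of_mem_ne 𝒮 m.2 h, DirectSum.decompose_of_mem_ne 𝒯 hm h, map_zero]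
  refine ⟨DirectSum.decompose 𝒮 x j, SetLike.coe_mem _, ?_⟩
  rw [key, DirectSum.decompose_of_mem_same 𝒯 hx]

end Forms

section Integrality

theorem exists_one_add_pow {S : Type} [CommRing S] (x : S) (i : ℕ) :
    ∃ y, (1 + x) ^ i = 1 + i * x + x ^ 2 * y := by
  obtain ⟨y, hy⟩ := Polynomial.powAddExpansion (1 : S) x i
  exact ⟨y, by rw [hy]; ring⟩

theorem exists_logForm_coeff {S : Type} [CommRing S] (t τ w : S) {n i : ℕ} (hn : 1 ≤ n)
    (hi : i ≤ n) (hw : w * (1 + t ^ (n - 1) * τ) = 1) :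
    ∃ g, w ^ i * (1 + n * t ^ (n - 1) * τ) - 1 = t ^ i * g := by
  have hwi : w ^ i * (1 + t ^ (n - 1) * τ) ^ i = 1 := by rw [← mul_pow, hw, one_pow]
  obtain ⟨m, rfl⟩ : ∃ m, n = m + 1 := ⟨n - 1, by omega⟩
  simp only [Nat.add_sub_cancel] at *
  rcases hi.eq_or_lt with rfl | hlt
  · rcases Nat.eq_zero_or_pos m with rfl | hm
    · refine ⟨0, ?_⟩
      simp only [pow_zero, zero_add, pow_one, Nat.cast_one] at *
      linear_combination hwi
    · obtain ⟨l, rfl⟩ : ∃ l, m = l + 1 := ⟨m - 1, by omega⟩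
      obtain ⟨y, hy⟩ := exists_one_add_pow (t ^ (l + 1) * τ) (l + 1 + 1)
      refine ⟨-(w ^ (l + 1 + 1) * t ^ l * τ ^ 2 * y), ?_⟩
      rw [hy] at hwi
      linear_combination hwi
  · obtain ⟨l, rfl⟩ : ∃ l, m = i + l := ⟨m - i, by omega⟩
    obtain ⟨y, hy⟩ := exists_one_add_pow (t ^ (i + l) * τ) i
    refine ⟨w ^ i * (((i + l + 1 : ℕ) : S) - i - t ^ (i + l) * τ * y) * t ^ l * τ, ?_⟩
    rw [hy] at hwi
    linear_combination hwi

theorem exists_unit_pow_sub_one {S : Type} [CommRing S] (t τ w : S) {n i : ℕ} (hn : 1 ≤ n)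
    (hi : i ≤ n - 1 ∨ ((n : S) = 0 ∧ 2 ≤ n ∧ i ≤ n)) (hw : w * (1 + t ^ (n - 1) * τ) = 1) :
    ∃ g, w ^ i - 1 = t ^ i * g := by
  have hi' : i ≤ n := by omega
  obtain ⟨g, hg⟩ := exists_logForm_coeff t τ w hn hi' hw
  rcases hi with hi | ⟨h0, -, -⟩
  · have h : t ^ (n - 1) = t ^ i * t ^ (n - 1 - i) := by rw [← pow_add]; congr 1; omega
    refine ⟨g - w ^ i * n * t ^ (n - 1 - i) * τ, ?_⟩
    rw [h] at hg
    linear_combination hg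
  · refine ⟨g, ?_⟩
    rw [h0] at hg
    linear_combination hg

variable {k}

/-- Two pullbacks along maps congruent modulo `t ^ n` differ by elements of the ideal generated by
`t ^ n` and `d(t ^ n)`. -/
theorem IsPullback.exists_congr {R S : Type} [CommRing R] [CommRing S] [Algebra k R] [Algebra k S]
    {φ₁ φ₂ : R →+* S} {Q₁ Q₂} (h₁ : IsPullback k R S φ₁ Q₁) (h₂ : IsPullback k R S φ₂ Q₂)
    (t : S) (n : ℕ) (h : ∀ a, ∃ x, φ₂ a - φ₁ a = t ^ n * x)
    (α : ExteriorAlgebra R (KaehlerDifferential k R)) :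
    ∃ X Y, Q₂ α = Q₁ α + t ^ n • X + ((n : S) * t ^ (n - 1)) • (dE k S t * Y) := by
  induction α using forms_induction with
  | hs a =>
    obtain ⟨x, hx⟩ := h a
    refine ⟨algebraMap _ _ x, 0, ?_⟩
    rw [h₁.1, h₂.1, sub_eq_iff_eq_add'.1 hx, map_add, map_mul, Algebra.smul_def, mul_zero,
      smul_zero, add_zero]
  | hD a =>
    obtain ⟨x, hx⟩ := h a
    refine ⟨dE k S x, algebraMap _ _ x, ?_⟩
    rw [h₁.2, h₂.2, sub_eq_iff_eq_add'.1 hx, dE_add, dE_mul, dE_pow, ← Algebra.commutes,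
      ← Algebra.smul_def, smul_comm x, add_assoc]
  | hadd x y hx hy =>
    obtain ⟨X, Y, hx⟩ := hx
    obtain ⟨X', Y', hy⟩ := hy
    refine ⟨X + X', Y + Y', ?_⟩
    rw [map_add, map_add, hx, hy, mul_add]
    module
  | hmul x y hx hy =>
    obtain ⟨X, Y, hx⟩ := hx
    obtain ⟨X', Y', hy⟩ := hy
    obtain ⟨Z, hZ⟩ := exists_mul_ι_comm (KaehlerDifferential.D k S t) (Q₁ x)
    change _ * dE k S t = dE k S t * _ at hZ
    refine ⟨X * Q₂ y + Q₁ x * X', Y * Q₂ y + Z * Y', ?_⟩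
    rw [mul_add, ← mul_assoc (dE k S t) Z, ← hZ, map_mul, map_mul, hx]
    conv_lhs => rw [add_mul, add_mul]
    conv_lhs => enter [1, 1]; rw [hy]
    simp only [mul_add, smul_mul_assoc, mul_smul_comm, mul_assoc]
    module

theorem exists_div_logForm {R S : Type} [CommRing R] [CommRing S] [Algebra k R] [Algebra k S]
    {φ₁ φ₂ : R →+* S} {Q₁ Q₂} (h₁ : IsPullback k R S φ₁ Q₁) (h₂ : IsPullback k R S φ₂ Q₂)
    (t τ w : S) {n i : ℕ} (h : ∀ a, ∃ x, φ₂ a - φ₁ a = t ^ n * x) (hn : 1 ≤ n) (hi : i ≤ n)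
    (hw : w * (1 + t ^ (n - 1) * τ) = 1) (α : ExteriorAlgebra R (KaehlerDifferential k R)) :
    ∃ Z, Q₂ α * (w ^ i • dE k S (t + t ^ n * τ)) - Q₁ α * dE k S t = t ^ i • Z := by
  obtain ⟨X, Y, hXY⟩ := h₁.exists_congr h₂ t n h α
  obtain ⟨g, hg⟩ := exists_logForm_coeff t τ w hn hi hw
  obtain ⟨Y', hY'⟩ := exists_mul_ι_comm (KaehlerDifferential.D k S t) Y
  change _ * dE k S t = dE k S t * _ at hY'
  have h0 : dE k S t * (Y * dE k S t) = 0 := by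
    rw [hY', ← mul_assoc, dE, ExteriorAlgebra.ι_sq_zero, zero_mul]
  have hds : dE k S (t + t ^ n * τ) =
      (1 + n * t ^ (n - 1) * τ) • dE k S t + t ^ n • dE k S τ := by
    rw [dE_add, dE_mul, dE_pow]; module
  have hg' : (w ^ i * (1 + n * t ^ (n - 1) * τ)) = 1 + t ^ i * g := by rw [← hg]; ring
  have hdt : t ^ n = t ^ i * t ^ (n - i) := by rw [← pow_add]; congr 1; omega
  refine ⟨g • (Q₁ α * dE k S t) + t ^ (n - i) • (w ^ i • (Q₁ α * dE k S τ) +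
    X * (w ^ i • dE k S (t + t ^ n * τ)) +
      ((n : S) * t ^ (n - 1) * w ^ i) • (dE k S t * (Y * dE k S τ))), ?_⟩
  rw [smul_add, smul_smul, smul_smul, ← hdt]
  have e1 : Q₁ α * (w ^ i • dE k S (t + t ^ n * τ)) =
      (1 + t ^ i * g) • (Q₁ α * dE k S t) + (t ^ n * w ^ i) • (Q₁ α * dE k S τ) := by
    rw [hds, ← hg']
    simp only [mul_add, smul_add, mul_smul_comm]
    module
  have e2 : dE k S t * Y * (w ^ i • dE k S (t + t ^ n * τ)) =
      (t ^ n * w ^ i) • (dE k S t * (Y * dE k S τ)) := by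
    rw [hds]
    simp only [mul_add, smul_add, mul_smul_comm, mul_assoc, h0, smul_zero, zero_add]
    module
  rw [hXY, add_mul, add_mul, smul_mul_assoc, smul_mul_assoc, e1, e2]
  module

theorem exists_div_form {R S : Type} [CommRing R] [CommRing S] [Algebra k R] [Algebra k S]
    {φ₁ φ₂ : R →+* S} {Q₁ Q₂} (h₁ : IsPullback k R S φ₁ Q₁) (h₂ : IsPullback k R S φ₂ Q₂)
    (t τ w : S) {n i : ℕ} (h : ∀ a, ∃ x, φ₂ a - φ₁ a = t ^ n * x) (hn : 1 ≤ n)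
    (hi : i ≤ n - 1 ∨ ((n : S) = 0 ∧ 2 ≤ n ∧ i ≤ n))
    (hw : w * (1 + t ^ (n - 1) * τ) = 1) (β : ExteriorAlgebra R (KaehlerDifferential k R)) :
    ∃ Z, w ^ i • Q₂ β - Q₁ β = t ^ i • Z := by
  obtain ⟨X, Y, hXY⟩ := h₁.exists_congr h₂ t n h β
  obtain ⟨g, hg⟩ := exists_unit_pow_sub_one t τ w hn hi hw
  have hdt : t ^ n = t ^ i * t ^ (n - i) := by rw [← pow_add]; congr 1; omega
  have hdt' : (n : S) * t ^ (n - 1) = t ^ i * (n * t ^ (n - 1 - i)) := by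
    rcases hi with hi | ⟨h0, -, -⟩
    · have : t ^ (n - 1) = t ^ i * t ^ (n - 1 - i) := by rw [← pow_add]; congr 1; omega
      rw [this]; ring
    · rw [h0]; ring
  refine ⟨g • Q₁ β + w ^ i • (t ^ (n - i) • X + ((n : S) * t ^ (n - 1 - i)) • (dE k S t * Y)), ?_⟩
  rw [hXY, hdt, hdt', sub_eq_iff_eq_add'.1 hg]
  module

end Integrality

section Sufficiency

variable {k}

theorem IsPullback.comp {S T U : Type} [CommRing S] [CommRing T] [CommRing U] [Algebra k S]
    [Algebra k T] [Algebra k U] {φ : S →+* T} {ψ : T →+* U} {P Q} (hP : IsPullback k S T φ P)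
    (hQ : IsPullback k T U ψ Q) : IsPullback k S U (ψ.comp φ) (Q.comp P) :=
  ⟨fun s => by simp [hP.1, hQ.1], fun s => by simp [hP.2, hQ.2]⟩

theorem IsPullback.map_smul {S T : Type} [CommRing S] [CommRing T] [Algebra k S]
    [Algebra k T] {φ : S →+* T} {P} (hP : IsPullback k S T φ P) (s : S) (x) :
    P (s • x) = φ s • P x := by
  rw [Algebra.smul_def, map_mul, hP.1, ← Algebra.smul_def]

theorem exists_isPullback {S T : Type} [CommRing S] [CommRing T] [Algebra k S]
    [Algebra k T] (φ : S →+* T) (hφ : ∀ c : k, φ (algebraMap k S c) = algebraMap k T c) :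
    ∃ P, IsPullback k S T φ P := by
  refine exists_forms_hom ((algebraMap T _).comp φ) (fun s x => Algebra.commutes _ _)
    ({ toFun := fun s => dE k T (φ s), map_zero' := by simp [dE],
       map_add' := fun a b => by simp [dE_add] } : S →+ _) (fun a b => ?_) (fun c => ?_)
    (fun a => ?_)
  · simp [dE_mul, Algebra.smul_def]
  · simp [hφ, dE]
  · exact ExteriorAlgebra.ι_sq_zero _

theorem exists_pullback_eq_sub {R S S' : Type} [CommRing R] [CommRing S] [CommRing S']
    [Algebra k R] [Algebra k S] [Algebra k S'] {φ₁ φ₂ : R →+* S}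
    (hφ₁ : ∀ c : k, φ₁ (algebraMap k R c) = algebraMap k S c)
    (hφ₂ : ∀ c : k, φ₂ (algebraMap k R c) = algebraMap k S c)
    (t τ w : S) {n : ℕ} (h : ∀ a, ∃ x, φ₂ a - φ₁ a = t ^ n * x) (hn : 1 ≤ n)
    (hw : w * (1 + t ^ (n - 1) * τ) = 1) {ψ : S →+* S'} {P G₁ G₂}
    (hP : IsPullback k S S' ψ P) (hG₁ : IsPullback k R S' (ψ.comp φ₁) G₁)
    (hG₂ : IsPullback k R S' (ψ.comp φ₂) G₂) (ti si : S') (hti : ψ t * ti = 1)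
    (hsi : ψ (t + t ^ n * τ) * si = 1) {q r : ℕ} (hq : q ≤ n)
    (hr : r ≤ n - 1 ∨ ((n : S) = 0 ∧ 2 ≤ n ∧ r ≤ n))
    (α : Fin q → ExteriorAlgebra R (KaehlerDifferential k R))
    (β : Fin r → ExteriorAlgebra R (KaehlerDifferential k R)) :
    ∃ ω, P ω =
      (∑ i : Fin q, G₂ (α i) * (si ^ ((i : ℕ) + 1) • dE k S' (ψ (t + t ^ n * τ))) +
        ∑ i : Fin r, si ^ ((i : ℕ) + 1) • G₂ (β i)) -
      (∑ i : Fin q, G₁ (α i) * (ti ^ ((i : ℕ) + 1) • dE k S' (ψ t)) +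
        ∑ i : Fin r, ti ^ ((i : ℕ) + 1) • G₁ (β i)) := by
  obtain ⟨Q₁, hQ₁⟩ := exists_isPullback φ₁ hφ₁
  obtain ⟨Q₂, hQ₂⟩ := exists_isPullback φ₂ hφ₂
  have hPQ₁ : ∀ x, G₁ x = P (Q₁ x) := forms_hom_ext (G := P.comp Q₁)
    (fun s => by rw [hG₁.1, (hQ₁.comp hP).1]) (fun s => by rw [hG₁.2, (hQ₁.comp hP).2])
  have hPQ₂ : ∀ x, G₂ x = P (Q₂ x) := forms_hom_ext (G := P.comp Q₂)
    (fun s => by rw [hG₂.1, (hQ₂.comp hP).1]) (fun s => by rw [hG₂.2, (hQ₂.comp hP).2])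
  have hs : t + t ^ n * τ = t * (1 + t ^ (n - 1) * τ) := by
    obtain ⟨m, rfl⟩ : ∃ m, n = m + 1 := ⟨n - 1, by omega⟩
    simp only [Nat.add_sub_cancel]; ring
  have hsw : si = ti * ψ w := by
    rw [hs, map_mul] at hsi
    have hw' : ψ w * ψ (1 + t ^ (n - 1) * τ) = 1 := by rw [← map_mul, hw, map_one]
    linear_combination (ti * ψ w) * hsi - si * ψ (1 + t ^ (n - 1) * τ) * ψ w * hti - si * hw'
  have hti' : ∀ i : ℕ, ti ^ i * ψ (t ^ i) = 1 := fun i => by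
    rw [map_pow, ← mul_pow, mul_comm, hti, one_pow]
  have key1 : ∀ i : Fin q, ∃ Z, P Z =
      G₂ (α i) * (si ^ ((i : ℕ) + 1) • dE k S' (ψ (t + t ^ n * τ))) -
        G₁ (α i) * (ti ^ ((i : ℕ) + 1) • dE k S' (ψ t)) := fun i => by
    obtain ⟨Z, hZ⟩ := exists_div_logForm hQ₁ hQ₂ t τ w h hn (i := (i : ℕ) + 1) (by omega) hw (α i)
    refine ⟨Z, ?_⟩
    have := congrArg (fun x => ti ^ ((i : ℕ) + 1) • P x) hZ
    simp only [map_sub, map_mul, hP.map_smul, hP.2, ← hPQ₁, ← hPQ₂] at this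
    rw [smul_smul, hti', one_smul] at this
    rw [← this, hsw, mul_pow, smul_sub, mul_smul_comm, mul_smul_comm, mul_smul_comm, smul_smul,
      map_pow]
  have key2 : ∀ i : Fin r, ∃ Z, P Z =
      si ^ ((i : ℕ) + 1) • G₂ (β i) - ti ^ ((i : ℕ) + 1) • G₁ (β i) := fun i => by
    obtain ⟨Z, hZ⟩ := exists_div_form hQ₁ hQ₂ t τ w h hn (i := (i : ℕ) + 1)
      (hr.imp (fun h => by omega) (fun h => ⟨h.1, h.2.1, by omega⟩)) hw (β i)
    refine ⟨Z, ?_⟩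
    have := congrArg (fun x => ti ^ ((i : ℕ) + 1) • P x) hZ
    simp only [map_sub, hP.map_smul, ← hPQ₁, ← hPQ₂] at this
    rw [smul_smul, hti', one_smul] at this
    rw [← this, hsw, mul_pow, smul_sub, smul_smul, map_pow]
  choose Z₁ hZ₁ using key1
  choose Z₂ hZ₂ using key2
  refine ⟨∑ i, Z₁ i + ∑ i, Z₂ i, ?_⟩
  simp only [map_add, map_sum, hZ₁, hZ₂, Finset.sum_sub_distrib]
  abel

end Sufficiency

section SquareZero

variable {k}

theorem exists_trivSqZeroExt_hom {R T M : Type} [CommRing R] [CommRing T] [AddCommGroup M]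
    [Module T M] [Module Tᵐᵒᵖ M] [IsCentralScalar T M] (f : R →+* T) (D : R →+ M)
    (hD : ∀ a b, D (a * b) = f a • D b + f b • D a) :
    ∃ g : R →+* TrivSqZeroExt T M, ∀ a, g a = TrivSqZeroExt.inl (f a) + TrivSqZeroExt.inr (D a) := by
  have h1 : D 1 = 0 := by simpa using hD 1 1
  refine ⟨{ toFun := fun a => TrivSqZeroExt.inl (f a) + TrivSqZeroExt.inr (D a), map_one' := ?_,
            map_mul' := fun a b => ?_, map_zero' := ?_, map_add' := fun a b => ?_ }, fun a => rfl⟩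
  · simp [h1]
  · ext
    · simp
    · simp [hD]
  · simp
  · ext <;> simp

theorem exists_trivSqZeroExt_map {T T' M M' : Type} [CommRing T] [AddCommGroup M]
    [Module T M] [Module Tᵐᵒᵖ M] [IsCentralScalar T M] [CommRing T'] [AddCommGroup M']
    [Module T' M'] [Module T'ᵐᵒᵖ M'] [IsCentralScalar T' M'] (f : T →+* T') (D : M →+ M')
    (hD : ∀ a b, D (a • b) = f a • D b) :
    ∃ g : TrivSqZeroExt T M →+* TrivSqZeroExt T' M',
      (∀ a, (g a).fst = f a.fst) ∧ (∀ a, (g a).snd = D a.snd) := by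
  refine ⟨{ toFun := fun a => TrivSqZeroExt.inl (f a.fst) + TrivSqZeroExt.inr (D a.snd),
            map_one' := ?_,
            map_mul' := fun a b => ?_, map_zero' := ?_, map_add' := fun a b => ?_ },
            fun a => by simp, fun a => by simp⟩
  · simp
  · ext
    · simp
    · simp [hD]
  · simp
  · ext <;> simp

theorem lTensor_mul_self {R T N E : Type} [CommRing R] [CommRing T] [Algebra R T]
    [AddCommGroup N] [Module R N] [Ring E] [Algebra R E] (ι : N →ₗ[R] E)
    (hι : ∀ v, ι v * ι v = 0) (x : T ⊗[R] N) :
    ι.lTensor T x * ι.lTensor T x = 0 := by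
  have anti : ∀ v w, ι v * ι w + ι w * ι v = 0 := fun v w => by
    have := hι (v + w)
    rw [map_add, mul_add, add_mul, add_mul, hι, hι, zero_add, add_zero, add_comm] at this
    exact this
  have h2 : ∀ x y : T ⊗[R] N,
      ι.lTensor T x * ι.lTensor T y + ι.lTensor T y * ι.lTensor T x = 0 := by
    intro x y
    induction x with
    | zero => simp
    | add a b ha hb => rw [map_add, add_mul, mul_add, add_add_add_comm, ha, hb, add_zero]
    | tmul a v =>
      induction y with
      | zero => simp
      | add c d hc hd => rw [map_add, add_mul, mul_add, add_add_add_comm, hc, hd, add_zero]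
      | tmul b w =>
        simp only [LinearMap.lTensor_tmul, Algebra.TensorProduct.tmul_mul_tmul]
        rw [mul_comm b a, ← TensorProduct.tmul_add, anti, TensorProduct.tmul_zero]
  induction x with
  | zero => simp
  | add a b ha hb =>
    rw [map_add, mul_add, add_mul, add_mul, ha, hb, zero_add, add_zero, add_comm, h2]
  | tmul a v => simp [hι]

theorem lTensor_smul {R T N E : Type} [CommRing R] [CommRing T] [Algebra R T]
    [AddCommGroup N] [Module R N] [Ring E] [Algebra R E] (ι : N →ₗ[R] E) (t : T) (x : T ⊗[R] N) :
    ι.lTensor T (t • x) = (t ⊗ₜ[R] (1 : E)) * ι.lTensor T x := by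
  induction x with
  | zero => simp
  | add a b ha hb => rw [smul_add, map_add, ha, hb, map_add, mul_add]
  | tmul a v => simp [TensorProduct.smul_tmul']

/-- A ring homomorphism into a square zero extension gives a ring homomorphism out of the algebra
of differential forms. -/
theorem exists_forms_hom_of_trivSqZeroExt {R T N E S : Type} [CommRing R] [CommRing T] [Algebra R T]
    [AddCommGroup N] [Module R N] [Ring E] [Algebra R E] (ι : N →ₗ[R] E)
    (hι : ∀ v, ι v * ι v = 0) [CommRing S] [Algebra k S]
    (h : S →+* TrivSqZeroExt T (T ⊗[R] N)) (hk : ∀ c : k, (h (algebraMap k S c)).snd = 0) :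
    ∃ F : ExteriorAlgebra S (KaehlerDifferential k S) →+* T ⊗[R] E,
      (∀ s : S, F (algebraMap S _ s) = (h s).fst ⊗ₜ[R] (1 : E)) ∧
        ∀ s : S, F (dE k S s) = ι.lTensor T (h s).snd := by
  let fst : TrivSqZeroExt T (T ⊗[R] N) →+* T :=
    { toFun := TrivSqZeroExt.fst, map_one' := rfl, map_mul' := fun _ _ => rfl, map_zero' := rfl,
      map_add' := fun _ _ => rfl }
  refine exists_forms_hom (k := k)
    ((Algebra.TensorProduct.includeLeftRingHom : T →+* T ⊗[R] E).comp (fst.comp h))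
    (fun s x => ?_)
    ({ toFun := fun s => ι.lTensor T (h s).snd, map_zero' := by simp,
       map_add' := fun a b => by simp } : S →+ _) (fun a b => ?_) (fun c => ?_)
    (fun a => lTensor_mul_self ι hι _)
  · change ((h s).fst ⊗ₜ[R] (1 : E)) * x = x * ((h s).fst ⊗ₜ[R] (1 : E))
    induction x with
    | zero => simp
    | add a b ha hb => rw [mul_add, add_mul, ha, hb]
    | tmul a v => simp [mul_comm]
  · change ι.lTensor T (h (a * b)).snd = ((h a).fst ⊗ₜ[R] (1 : E)) * ι.lTensor T (h b).snd +
      ((h b).fst ⊗ₜ[R] (1 : E)) * ι.lTensor T (h a).snd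
    rw [map_mul, TrivSqZeroExt.snd_mul, op_smul_eq_smul, map_add, lTensor_smul, lTensor_smul]
  · change ι.lTensor T (h (algebraMap k S c)).snd = 0
    rw [hk, map_zero]

end SquareZero

section Contraction

theorem eq_zero_of_contractLeft {R N : Type} [CommRing R] [AddCommGroup N] [Module R N] {ι : Type}
    [Fintype ι] (b : Module.Basis ι R N) {j : ℕ} (hj : 1 ≤ j) {x : ExteriorAlgebra R N}
    (hx : x ∈ (LinearMap.range (ExteriorAlgebra.ι R : N →ₗ[R] ExteriorAlgebra R N)) ^ j)
    (h : ∀ i, CliffordAlgebra.contractLeft (Q := (0 : QuadraticForm R N)) (b.coord i) x = 0) :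
    x = 0 := by
  classical
  have step : ∀ (s : List ι), s.Nodup → ∃ y : ExteriorAlgebra R N,
      (∀ i ∈ s, y * ExteriorAlgebra.ι R (b i) = 0) ∧
      (∀ i ∉ s, CliffordAlgebra.contractLeft (Q := (0 : QuadraticForm R N)) (b.coord i) (y * x) = 0)
      ∧ (y * x = 0 → x = 0) := by
    intro s
    induction s with
    | nil => intro _; exact ⟨1, by simp, by simpa using h, by simp⟩
    | cons a s ih =>
      intro hs
      obtain ⟨has, hs⟩ := List.nodup_cons.1 hs
      obtain ⟨y, hy1, hy2, hy3⟩ := ih hs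
      refine ⟨ExteriorAlgebra.ι R (b a) * y, fun i hi => ?_, fun i hi => ?_, fun h0 => hy3 ?_⟩
      · rcases List.mem_cons.1 hi with rfl | hi
        · obtain ⟨y', hy'⟩ := exists_mul_ι_comm (b i) y
          rw [mul_assoc, hy', ← mul_assoc, ExteriorAlgebra.ι_sq_zero, zero_mul]
        · rw [mul_assoc, hy1 i hi, mul_zero]
      · rw [List.mem_cons, not_or] at hi
        rw [mul_assoc]
        refine (CliffordAlgebra.contractLeft_ι_mul _ _ _).trans ?_
        rw [hy2 i hi.2, mul_zero, sub_zero, Module.Basis.coord_apply, Module.Basis.repr_self,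
          Finsupp.single_eq_of_ne hi.1, zero_smul]
      · have := CliffordAlgebra.contractLeft_ι_mul (Q := (0 : QuadraticForm R N)) (d := b.coord a)
          (b a) (y * x)
        rw [hy2 a has, mul_zero, sub_zero, Module.Basis.coord_apply, Module.Basis.repr_self,
          Finsupp.single_eq_same, one_smul] at this
        rw [mul_assoc] at h0
        rw [← this]
        refine (congrArg _ h0).trans (map_zero _)
  obtain ⟨y, hy1, -, hy3⟩ := step Finset.univ.toList (Finset.nodup_toList _)
  apply hy3
  have hι : ∀ v : N, y * ExteriorAlgebra.ι R v = 0 := fun v => by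
    rw [← b.sum_repr v, map_sum, Finset.mul_sum]
    refine Finset.sum_eq_zero fun i _ => ?_
    rw [map_smul, mul_smul_comm, hy1 i (by simp), smul_zero]
  obtain ⟨i, rfl⟩ := Nat.exists_eq_add_of_le' hj
  rw [pow_succ'] at hx
  refine Submodule.mul_induction_on (C := fun z => y * z = 0) hx (fun m hm z _ => ?_)
    fun u v hu hv => by rw [mul_add, hu, hv, add_zero]
  obtain ⟨v, rfl⟩ := hm
  rw [← mul_assoc, hι, zero_mul]

end Contraction

section TriangularForms

variable {k}

/-- The matrix with diagonal entries the grade involution of `x` and `x`, and upper right entry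
`c`. -/
def formsBlock (R N : Type) [CommRing R] [AddCommGroup N] [Module R N] :
    (ExteriorAlgebra R N × ExteriorAlgebra R N) →ₗ[R]
      Matrix (Fin 2) (Fin 2) (ExteriorAlgebra R N) where
  toFun x := !![CliffordAlgebra.involute (Q := (0 : QuadraticForm R N)) x.1, x.2; 0, x.1]
  map_add' x y := by ext i j; fin_cases i <;> fin_cases j <;> simp
  map_smul' a x := by ext i j; fin_cases i <;> fin_cases j <;> simp

variable {R N : Type} [CommRing R] [AddCommGroup N] [Module R N]

theorem formsBlock_mul (x c y d : ExteriorAlgebra R N) :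
    formsBlock R N (x, c) * formsBlock R N (y, d) = formsBlock R N
      (x * y, CliffordAlgebra.involute (Q := (0 : QuadraticForm R N)) x * d + c * y) := by
  ext i j; fin_cases i <;> fin_cases j <;> simp [formsBlock, Matrix.mul_apply]

theorem formsBlock_algebraMap (a : R) :
    formsBlock R N (algebraMap R _ a, 0) = algebraMap R _ a := by
  ext i j; fin_cases i <;> fin_cases j <;>
    simp [formsBlock, Matrix.algebraMap_matrix_apply]

/-- The extension of the degree one inclusion `N → ⋀ N` to `N × R` by square zero matrices. -/
def formsBlockι (R N : Type) [CommRing R] [AddCommGroup N] [Module R N] :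
    (N × R) →ₗ[R] Matrix (Fin 2) (Fin 2) (ExteriorAlgebra R N) :=
  formsBlock R N ∘ₗ
    LinearMap.prodMap (ExteriorAlgebra.ι R) (Algebra.linearMap R (ExteriorAlgebra R N))

theorem formsBlockι_apply (v : N) (r : R) :
    formsBlockι R N (v, r) = formsBlock R N (ExteriorAlgebra.ι R v, algebraMap R _ r) := rfl

theorem formsBlockι_mul_self (v : N × R) : formsBlockι R N v * formsBlockι R N v = 0 := by
  obtain ⟨v, r⟩ := v
  have h : CliffordAlgebra.involute (Q := (0 : QuadraticForm R N)) (ExteriorAlgebra.ι R v) =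
    -ExteriorAlgebra.ι R v := CliffordAlgebra.involute_ι v
  rw [formsBlockι_apply, formsBlock_mul, h, ExteriorAlgebra.ι_sq_zero, Algebra.commutes, neg_mul,
    neg_add_cancel]
  exact map_zero _

theorem forms_hom_eq_contractLeft {T R : Type} [CommRing R] [Algebra k R] [CommRing T] [Algebra R T]
    (lam : Module.Dual R (KaehlerDifferential k R)) (y : T)
    (G : ExteriorAlgebra R (KaehlerDifferential k R) →+*
      T ⊗[R] Matrix (Fin 2) (Fin 2) (ExteriorAlgebra R (KaehlerDifferential k R)))
    (hG : ∀ a, G (algebraMap R _ a) = algebraMap R T a ⊗ₜ 1)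
    (hGd : ∀ a, G (dE k R a) = 1 ⊗ₜ formsBlockι R _ (KaehlerDifferential.D k R a, 0) +
      y ⊗ₜ formsBlockι R _ (0, lam (KaehlerDifferential.D k R a)))
    (x : ExteriorAlgebra R (KaehlerDifferential k R)) :
    G x = 1 ⊗ₜ formsBlock R _ (x, 0) + y ⊗ₜ formsBlock R _ (0,
      CliffordAlgebra.contractLeft (Q := (0 : QuadraticForm R (KaehlerDifferential k R))) lam x) := by
  have hG' : ∀ a, G (algebraMap R _ a) = algebraMap R _ a := fun a => by
    rw [hG]; rfl
  have hι : ∀ v, G (ExteriorAlgebra.ι R v) = 1 ⊗ₜ formsBlockι R _ (v, 0) +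
      y ⊗ₜ formsBlockι R _ (0, lam v) := by
    intro v
    induction v using kaehler_induction (k := k) with
    | hz =>
      rw [map_zero, map_zero, map_zero, ← Prod.zero_eq_mk, map_zero, tmul_zero, tmul_zero, add_zero]
    | hD s => exact hGd s
    | hadd v w hv hw =>
      have h1 : ((v + w, 0) : KaehlerDifferential k R × R) = (v, 0) + (w, 0) := by simp
      have h2 : ((0, lam v + lam w) : KaehlerDifferential k R × R) = (0, lam v) + (0, lam w) := by
        simp
      rw [map_add, map_add, hv, hw, map_add, h1, h2, map_add, map_add, tmul_add, tmul_add]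
      abel
    | hsmul s v hv =>
      have h1 : ((s • v, 0) : KaehlerDifferential k R × R) = s • (v, 0) := by simp
      have h2 : ((0, lam (s • v)) : KaehlerDifferential k R × R) = s • (0, lam v) := by simp
      rw [h1, h2, map_smul (formsBlockι R _), map_smul (formsBlockι R _),
        map_smul (ExteriorAlgebra.ι R), Algebra.smul_def s (ExteriorAlgebra.ι R v), map_mul, hG',
        hv, tmul_smul, tmul_smul, ← smul_add]
      exact (Algebra.smul_def _ _).symm
  induction x using CliffordAlgebra.left_induction with
  | algebraMap r =>
    refine (hG' r).trans ?_
    rw [CliffordAlgebra.contractLeft_algebraMap, ← Prod.zero_eq_mk, map_zero, tmul_zero, add_zero]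
    exact (Algebra.TensorProduct.algebraMap_apply' r).trans
      (congrArg (fun z => (1 : T) ⊗ₜ[R] z)
        (formsBlock_algebraMap (N := KaehlerDifferential k R) r).symm)
  | add u v hu hv =>
    have h1 : ∀ u v : ExteriorAlgebra R (KaehlerDifferential k R),
      (u + v, (0 : ExteriorAlgebra R (KaehlerDifferential k R))) = (u, 0) + (v, 0) := by simp
    have h2 : ∀ u v : ExteriorAlgebra R (KaehlerDifferential k R),
      ((0 : ExteriorAlgebra R (KaehlerDifferential k R)), u + v) = (0, u) + (0, v) := by simp
    rw [map_add, hu, hv, map_add, h1, h2, map_add, map_add, tmul_add, tmul_add]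
    abel
  | ι_mul x m hx =>
    have h3 : CliffordAlgebra.involute (Q := (0 : QuadraticForm R (KaehlerDifferential k R)))
      (ExteriorAlgebra.ι R m) = -ExteriorAlgebra.ι R m := CliffordAlgebra.involute_ι m
    rw [CliffordAlgebra.contractLeft_ι_mul, map_mul, hx]
    refine (congrArg (· * _) (hι m)).trans ?_
    rw [formsBlockι_apply, formsBlockι_apply, mul_add, add_mul, add_mul]
    simp only [Algebra.TensorProduct.tmul_mul_tmul, formsBlock_mul, h3, map_zero, zero_mul,
      mul_zero, add_zero, zero_add, one_mul, mul_one, neg_mul]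
    rw [← Prod.zero_eq_mk, map_zero, tmul_zero, add_zero, add_assoc, ← tmul_add, ← map_add,
      Prod.mk_add_mk, add_zero, ← Algebra.smul_def, sub_eq_add_neg]

end TriangularForms

section Evaluation

variable {k}

theorem forms_hom_polar_eq {R A T : Type} [CommRing R] [Algebra k R] [CommRing A] [Algebra k A]
    [CommRing T] [Algebra R T] (φ : R →+* A)
    (ιR : ExteriorAlgebra R (KaehlerDifferential k R) →+*
      ExteriorAlgebra A (KaehlerDifferential k A)) (hι : IsPullback k R A φ ιR)
    (lam : Module.Dual R (KaehlerDifferential k R)) (κ : R) (y x : T) (z zi : A)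
    (H : ExteriorAlgebra A (KaehlerDifferential k A) →+*
      T ⊗[R] Matrix (Fin 2) (Fin 2) (ExteriorAlgebra R (KaehlerDifferential k R)))
    (hH : ∀ a, H (algebraMap A _ (φ a)) = algebraMap R T a ⊗ₜ 1)
    (hHd : ∀ a, H (dE k A (φ a)) = 1 ⊗ₜ formsBlockι R _ (KaehlerDifferential.D k R a, 0) +
      y ⊗ₜ formsBlockι R _ (0, lam (KaehlerDifferential.D k R a)))
    (hzi : H (algebraMap A _ zi) = x ⊗ₜ 1)
    (hz : H (dE k A z) = y ⊗ₜ formsBlockι R _ (0, κ)) {q r : ℕ}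
    (α : Fin q → ExteriorAlgebra R (KaehlerDifferential k R))
    (β : Fin r → ExteriorAlgebra R (KaehlerDifferential k R)) :
    H ((∑ i : Fin q, ιR (α i) * ((zi ^ ((i : ℕ) + 1)) • dE k A z)) +
          ∑ i : Fin r, (zi ^ ((i : ℕ) + 1)) • ιR (β i)) =
      (∑ i : Fin q, (x ^ ((i : ℕ) + 1) * y) ⊗ₜ formsBlock R _ (0, κ •
        CliffordAlgebra.involute (Q := (0 : QuadraticForm R (KaehlerDifferential k R))) (α i))) +
      ∑ i : Fin r, ((x ^ ((i : ℕ) + 1)) ⊗ₜ formsBlock R _ (β i, 0) +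
        (x ^ ((i : ℕ) + 1) * y) ⊗ₜ formsBlock R _ (0, CliffordAlgebra.contractLeft
          (Q := (0 : QuadraticForm R (KaehlerDifferential k R))) lam (β i))) := by
  have hG := forms_hom_eq_contractLeft lam y (H.comp ιR)
    (fun a => by rw [RingHom.comp_apply, hι.1, hH]) (fun a => by rw [RingHom.comp_apply, hι.2, hHd])
  have hpow : ∀ m : ℕ, H (algebraMap A _ (zi ^ m)) = (x ^ m) ⊗ₜ 1 := fun m => by
    rw [map_pow, map_pow, hzi, Algebra.TensorProduct.tmul_pow, one_pow]
  rw [map_add, map_sum, map_sum]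
  congr 1
  · refine Finset.sum_congr rfl fun i _ => ?_
    rw [mul_smul_comm, Algebra.smul_def, map_mul, map_mul, hpow, hz, ← RingHom.comp_apply, hG,
      formsBlockι_apply]
    simp only [map_zero, add_mul, Algebra.TensorProduct.tmul_mul_tmul, formsBlock_mul, zero_mul,
      mul_zero, add_zero, one_mul, Prod.mk_zero_zero, tmul_zero]
    rw [← Algebra.commutes, ← Algebra.smul_def]
  · refine Finset.sum_congr rfl fun i _ => ?_
    rw [Algebra.smul_def, map_mul, hpow, ← RingHom.comp_apply, hG, mul_add,
      Algebra.TensorProduct.tmul_mul_tmul, Algebra.TensorProduct.tmul_mul_tmul, one_mul, one_mul,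
      mul_one]

end Evaluation

section Obstruction

variable {k}

theorem exists_trivSqZeroExt_hom_kaehler {R T : Type} [CommRing R] [Algebra k R] [CommRing T]
    [Algebra R T] (lam : Module.Dual R (KaehlerDifferential k R)) (y : T) :
    ∃ g : R →+* TrivSqZeroExt T (T ⊗[R] (KaehlerDifferential k R × R)),
      ∀ a, g a = TrivSqZeroExt.inl (algebraMap R T a) +
        TrivSqZeroExt.inr (1 ⊗ₜ (KaehlerDifferential.D k R a, 0) +
          y ⊗ₜ (0, lam (KaehlerDifferential.D k R a))) := by
  refine exists_trivSqZeroExt_hom (algebraMap R T)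
    (({ toFun := fun v => 1 ⊗ₜ (v, 0) + y ⊗ₜ (0, lam v), map_zero' := ?_, map_add' := ?_ } :
      KaehlerDifferential k R →+ T ⊗[R] (KaehlerDifferential k R × R)).comp
        (KaehlerDifferential.D k R : R →+ KaehlerDifferential k R)) fun a b => ?_
  · rw [map_zero, ← Prod.zero_eq_mk, tmul_zero, tmul_zero, add_zero]
  · intro v w
    have h1 : ((v + w, 0) : KaehlerDifferential k R × R) = (v, 0) + (w, 0) := by simp
    have h2 : ((0, lam v + lam w) : KaehlerDifferential k R × R) = (0, lam v) + (0, lam w) := by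
      simp
    rw [map_add, h1, h2, tmul_add, tmul_add]
    abel
  · have h1 : ∀ (a : R) (v : KaehlerDifferential k R),
        ((a • v, 0) : KaehlerDifferential k R × R) = a • (v, 0) := by simp
    have h2 : ∀ (a : R) (r : R), ((0, a * r) : KaehlerDifferential k R × R) = a • (0, r) := by simp
    simp only [AddMonoidHom.comp_apply, AddMonoidHom.coe_mk, ZeroHom.coe_mk, AddMonoidHom.coe_coe,
      Derivation.leibniz, map_add, map_smul, smul_eq_mul, algebraMap_smul, smul_add]
    rw [h1, h1, h2, h2, tmul_smul, tmul_smul, tmul_smul, tmul_smul]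

theorem exists_test_hom_Cdil {e : ℕ} {R : Type} [CommRing R] [Algebra k R]
    [Algebra (MvPolynomial (Fin e) k) R]
    (M : Submonoid (PolyA R ⊗[k] PolyA R))
    (hM : ∀ x ∈ M,
      IsUnit ((Algebra.TensorProduct.lmul' k (S := PolyA R) :
        PolyA R ⊗[k] PolyA R →ₐ[k] PolyA R) x))
    (B : Type) [CommRing B] [Algebra (PolyA R ⊗[k] PolyA R) B] [IsLocalization M B]
    [Algebra k B] [IsScalarTower k (PolyA R ⊗[k] PolyA R) B] (n : ℕ)
    {T : Type} [CommRing T] [Algebra R T] (π : T →+* PolyA R) [IsLocalHom π]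
    (hπ : ∀ a, π (algebraMap R T a) = Polynomial.C a) (z c : T) (hz : π z = Polynomial.X)
    (hc : π c = 0) (lam : Module.Dual R (KaehlerDifferential k R)) (κ : R) :
    ∃ h : Cdil k e R n B →+* TrivSqZeroExt T (T ⊗[R] (KaehlerDifferential k R × R)),
      (∀ a, h (tensorToCdil k e R n B (Polynomial.C a ⊗ₜ[k] (1 : PolyA R))) =
        TrivSqZeroExt.inl (algebraMap R T a) +
          TrivSqZeroExt.inr (1 ⊗ₜ (KaehlerDifferential.D k R a, 0))) ∧
      h (tensorToCdil k e R n B (Polynomial.X ⊗ₜ[k] (1 : PolyA R))) = TrivSqZeroExt.inl z ∧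
      (∀ a, h (tensorToCdil k e R n B ((1 : PolyA R) ⊗ₜ[k] Polynomial.C a)) =
        TrivSqZeroExt.inl (algebraMap R T a) +
          TrivSqZeroExt.inr (1 ⊗ₜ (KaehlerDifferential.D k R a, 0) +
          (z ^ n) ⊗ₜ (0, lam (KaehlerDifferential.D k R a)))) ∧
      h (tensorToCdil k e R n B ((1 : PolyA R) ⊗ₜ[k] Polynomial.X)) =
        TrivSqZeroExt.inl (z + z ^ n * c) + TrivSqZeroExt.inr ((z ^ n) ⊗ₜ (0, κ)) := by
  obtain ⟨f₁, hf₁⟩ := exists_trivSqZeroExt_hom_kaehler (k := k) (R := R) lam (0 : T)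
  obtain ⟨f₂, hf₂⟩ := exists_trivSqZeroExt_hom_kaehler (k := k) (R := R) lam (z ^ n)
  simp only [zero_tmul, add_zero] at hf₁
  let fst : TrivSqZeroExt T (T ⊗[R] (KaehlerDifferential k R × R)) →+* T :=
    { toFun := TrivSqZeroExt.fst, map_one' := rfl, map_mul' := fun _ _ => rfl, map_zero' := rfl,
      map_add' := fun _ _ => rfl }
  have hfst : ∀ x, fst x = x.fst := fun _ => rfl
  have _ : IsLocalHom fst := ⟨fun x hx => TrivSqZeroExt.isUnit_iff_isUnit_fst.2 hx⟩
  have _ : IsLocalHom (π.comp fst) := RingHom.isLocalHom_comp π fst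
  let g₁ := Polynomial.eval₂RingHom f₁ (TrivSqZeroExt.inl z)
  let g₂ := Polynomial.eval₂RingHom f₂
    (TrivSqZeroExt.inl (z + z ^ n * c) + TrivSqZeroExt.inr ((z ^ n) ⊗ₜ (0, κ)))
  have h1C : ∀ a, g₁ (Polynomial.C a) = f₁ a := fun a => Polynomial.eval₂_C _ _
  have h1X : g₁ Polynomial.X = TrivSqZeroExt.inl z := Polynomial.eval₂_X _ _
  have h2C : ∀ a, g₂ (Polynomial.C a) = f₂ a := fun a => Polynomial.eval₂_C _ _
  have h2X : g₂ Polynomial.X = TrivSqZeroExt.inl (z + z ^ n * c) +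
    TrivSqZeroExt.inr ((z ^ n) ⊗ₜ (0, κ)) := Polynomial.eval₂_X _ _
  have hk : ∀ c : k, g₂ (algebraMap k (PolyA R) c) = g₁ (algebraMap k (PolyA R) c) := fun c => by
    rw [Polynomial.algebraMap_apply, h1C, h2C, hf₁, hf₂, Derivation.map_algebraMap, map_zero,
      ← Prod.zero_eq_mk, tmul_zero, tmul_zero, add_zero]
  have hπ₁ : (π.comp fst).comp g₁ = RingHom.id _ := by
    refine Polynomial.ringHom_ext (fun a => ?_) ?_
    · change π (fst (g₁ _)) = _
      rw [h1C, hf₁, hfst]; simp [hπ]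
    · change π (fst (g₁ _)) = _
      rw [h1X, hfst]; simp [hz]
  have hπ₂ : (π.comp fst).comp g₂ = RingHom.id _ := by
    refine Polynomial.ringHom_ext (fun a => ?_) ?_
    · change π (fst (g₂ _)) = _
      rw [h2C, hf₂, hfst]; simp [hπ]
    · change π (fst (g₂ _)) = _
      rw [h2X, hfst]; simp [hz, hc]
  let τ : Fin (e + 1) → TrivSqZeroExt T (T ⊗[R] (KaehlerDifferential k R × R)) :=
    Fin.cons (TrivSqZeroExt.inl c + TrivSqZeroExt.inr (1 ⊗ₜ (0, κ))) fun i =>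
      TrivSqZeroExt.inr (1 ⊗ₜ (0, lam (KaehlerDifferential.D k R
        (algebraMap (MvPolynomial (Fin e) k) R (MvPolynomial.X i)))))
  have hτ0 : τ 0 = TrivSqZeroExt.inl c + TrivSqZeroExt.inr (1 ⊗ₜ (0, κ)) := rfl
  have hτs : ∀ i : Fin e, τ i.succ = TrivSqZeroExt.inr (1 ⊗ₜ (0, lam (KaehlerDifferential.D k R
    (algebraMap (MvPolynomial (Fin e) k) R (MvPolynomial.X i))))) := fun _ => rfl
  have hτ : (π.comp fst) (τ 0) = 0 := by
    rw [hτ0, RingHom.comp_apply, hfst]; simp [hc]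
  have h0 : g₂ Polynomial.X - g₁ Polynomial.X = τ 0 * g₁ Polynomial.X ^ n := by
    rw [h1X, h2X, hτ0, TrivSqZeroExt.inl_pow]
    ext
    · simp [mul_comm]
    · simp [TensorProduct.smul_tmul']
  have hs : ∀ i, g₂ (zElt k e R i) - g₁ (zElt k e R i) = τ i.succ * g₁ Polynomial.X ^ n := by
    intro i
    rw [h1X, hτs, zElt, h1C, h2C, hf₁, hf₂, TrivSqZeroExt.inl_pow]
    ext
    · simp
    · simp [TensorProduct.smul_tmul']
  obtain ⟨h, hh1, hh2⟩ := exists_ringHom_Cdil (e := e) (n := n) (B := B) M hM g₁ g₂ hk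
    (π.comp fst) (fun a => RingHom.congr_fun hπ₁ a) (fun a => RingHom.congr_fun hπ₂ a) τ hτ h0 hs
  refine ⟨h, fun a => ?_, ?_, fun a => ?_, ?_⟩
  · rw [hh1, h1C, hf₁]
  · rw [hh1, h1X]
  · rw [hh2, h2C, hf₂]
  · rw [hh2, h2X]

end Obstruction

section PolarVanishing

variable {k}

/-- The vanishing of the pairing of the polar part of a form, with coefficients `α` and `β`, with
all pairs of `R`-algebras `T → T'` and functionals `μ` on `T'` that vanish on `T`. -/
def PolarVanishing (k : Type) [Field k] {R : Type} [CommRing R] [Algebra k R] (n : ℕ) {q r : ℕ}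
    (α : Fin q → ExteriorAlgebra R (KaehlerDifferential k R))
    (β : Fin r → ExteriorAlgebra R (KaehlerDifferential k R)) : Prop :=
  ∀ (T T' : Type) [CommRing T] [Algebra R T] [CommRing T'] [Algebra R T'] (J : T →ₐ[R] T')
    (π : T →+* PolyA R) [IsLocalHom π]
    (_ : ∀ a, π (algebraMap R T a) = Polynomial.C a) (z c : T) (_ : π z = Polynomial.X)
    (_ : π c = 0) (lam : Module.Dual R (KaehlerDifferential k R)) (κ : R)
    (ti si : T') (_ : J z * ti = 1) (_ : J (z + z ^ n * c) * si = 1)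
    (μ : T' →ₗ[R] R) (_ : ∀ t, μ (J t) = 0),
    (∑ i : Fin q, μ (si ^ ((i : ℕ) + 1) * J z ^ n) • (κ •
        CliffordAlgebra.involute (Q := (0 : QuadraticForm R (KaehlerDifferential k R))) (α i))) +
      ∑ i : Fin r, μ (si ^ ((i : ℕ) + 1) * J z ^ n) • CliffordAlgebra.contractLeft
          (Q := (0 : QuadraticForm R (KaehlerDifferential k R))) lam (β i) = 0 ∧
    ∑ i : Fin r, (μ (si ^ ((i : ℕ) + 1)) - μ (ti ^ ((i : ℕ) + 1))) • β i = 0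

/-- Testing a form on `C[1/t]` with a pole, which extends to `C`, on pairs of `R`-algebras
`T → T'` together with a functional on `T'` that vanishes on `T`. -/
theorem polar_vanishing {e : ℕ} {R : Type} [CommRing R] [Algebra k R]
    [Algebra (MvPolynomial (Fin e) k) R]
    (M : Submonoid (PolyA R ⊗[k] PolyA R))
    (hM : ∀ x ∈ M,
      IsUnit ((Algebra.TensorProduct.lmul' k (S := PolyA R) :
        PolyA R ⊗[k] PolyA R →ₐ[k] PolyA R) x))
    (B : Type) [CommRing B] [Algebra (PolyA R ⊗[k] PolyA R) B] [IsLocalization M B]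
    [Algebra k B] [IsScalarTower k (PolyA R ⊗[k] PolyA R) B] (n : ℕ)
    (Az : Type) [CommRing Az] [Algebra (PolyA R) Az] [Algebra k Az]
    (Ct : Type) [CommRing Ct] [Algebra (Cdil k e R n B) Ct]
    [IsLocalization.Away (tC k e R n B) Ct]
    [Algebra k Ct] [IsScalarTower k (Cdil k e R n B) Ct]
    (zi : Az) (hzi : algebraMap (PolyA R) Az Polynomial.X * zi = 1)
    (P1 P2 : Az →+* Ct)
    (hP1 : ∀ a : PolyA R, P1 (algebraMap (PolyA R) Az a) =
      canTA k e R n B Ct (a ⊗ₜ[k] (1 : PolyA R)))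
    (hP2 : ∀ a : PolyA R, P2 (algebraMap (PolyA R) Az a) =
      canTA k e R n B Ct ((1 : PolyA R) ⊗ₜ[k] a))
    (Pull1 Pull2 : ExteriorAlgebra Az (KaehlerDifferential k Az) →+*
      ExteriorAlgebra Ct (KaehlerDifferential k Ct))
    (hPull1 : IsPullback k Az Ct P1 Pull1)
    (hPull2 : IsPullback k Az Ct P2 Pull2)
    (ιR : ExteriorAlgebra R (KaehlerDifferential k R) →+*
      ExteriorAlgebra Az (KaehlerDifferential k Az))
    (hιR : IsPullback k R Az
      ((algebraMap (PolyA R) Az).comp (Polynomial.C : R →+* PolyA R)) ιR)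
    (cstar : ExteriorAlgebra (Cdil k e R n B) (KaehlerDifferential k (Cdil k e R n B)) →+*
      ExteriorAlgebra Ct (KaehlerDifferential k Ct))
    (hcstar : IsPullback k (Cdil k e R n B) Ct
      (algebraMap (Cdil k e R n B) Ct) cstar)
    {q r : ℕ} {α : Fin q → ExteriorAlgebra R (KaehlerDifferential k R)}
    {β : Fin r → ExteriorAlgebra R (KaehlerDifferential k R)} {ω}
    (hω : cstar ω =
        Pull2 ((∑ i : Fin q, ιR (α i) *
            ((zi ^ ((i : ℕ) + 1)) • dE k Az (algebraMap (PolyA R) Az Polynomial.X))) +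
          ∑ i : Fin r, (zi ^ ((i : ℕ) + 1)) • ιR (β i)) -
        Pull1 ((∑ i : Fin q, ιR (α i) *
            ((zi ^ ((i : ℕ) + 1)) • dE k Az (algebraMap (PolyA R) Az Polynomial.X))) +
          ∑ i : Fin r, (zi ^ ((i : ℕ) + 1)) • ιR (β i))) :
    PolarVanishing k n α β := by
  intro T T' _ _ _ _ J π _ hπ z c hz hc lam κ ti si hti hsi μ hμ
  obtain ⟨h, h1C, h1X, h2C, h2X⟩ :=
    exists_test_hom_Cdil (k := k) (e := e) M hM B n π hπ z c hz hc lam κ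
  obtain ⟨m, hm1, hm2⟩ := exists_trivSqZeroExt_map (J : T →+* T')
    (LinearMap.rTensor (KaehlerDifferential k R × R) J.toLinearMap).toAddMonoidHom (by
      intro a b
      induction b with
      | zero => simp
      | add x y hx hy => rw [smul_add, map_add, hx, hy, map_add, smul_add]
      | tmul x y => simp [TensorProduct.smul_tmul'])
  have hm2' : ∀ a, (m a).snd =
    LinearMap.rTensor (KaehlerDifferential k R × R) J.toLinearMap a.snd := hm2
  have hunit : IsUnit ((m.comp h) (tC k e R n B)) := by
    rw [TrivSqZeroExt.isUnit_iff_isUnit_fst, RingHom.comp_apply, hm1, tC_eq, tElt, h1X]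
    exact IsUnit.of_mul_eq_one ti hti
  let h' : Ct →+* TrivSqZeroExt T' (T' ⊗[R] (KaehlerDifferential k R × R)) :=
    IsLocalization.Away.lift (tC k e R n B) hunit
  have hh' : ∀ x, h' (algebraMap (Cdil k e R n B) Ct x) = m (h x) :=
    fun x => IsLocalization.Away.lift_eq _ _ _
  have hk : ∀ c : k, (h (algebraMap k _ c)).snd = 0 := fun c => by
    rw [algebraMap_Cdil_eq, Polynomial.algebraMap_apply, h1C, Derivation.map_algebraMap,
      ← Prod.zero_eq_mk, tmul_zero]
    simp
  obtain ⟨F, hF, hFd⟩ := exists_forms_hom_of_trivSqZeroExt (k := k)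
    (formsBlockι R (KaehlerDifferential k R)) formsBlockι_mul_self h hk
  obtain ⟨F', hF', hFd'⟩ := exists_forms_hom_of_trivSqZeroExt (k := k)
    (formsBlockι R (KaehlerDifferential k R)) formsBlockι_mul_self h' (fun c => by
      rw [IsScalarTower.algebraMap_apply k (Cdil k e R n B) Ct, hh', hm2', hk, map_zero])
  have hcomp : ∀ x, F' (cstar x) = Algebra.TensorProduct.map J (AlgHom.id R _) (F x) := by
    refine forms_hom_ext (F := F'.comp cstar)
      (G := (Algebra.TensorProduct.map J (AlgHom.id R _)).toRingHom.comp F) (fun s => ?_) fun s => ?_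
    · change F' (cstar _) = Algebra.TensorProduct.map J (AlgHom.id R _) (F _)
      rw [hcstar.1, hF', hF, hh', hm1]
      simp
    · change F' (cstar _) = Algebra.TensorProduct.map J (AlgHom.id R _) (F _)
      rw [hcstar.2, hFd', hFd, hh', hm2']
      generalize (h s).snd = x
      induction x with
      | zero => simp
      | add x y hx hy => simp only [map_add, hx, hy]
      | tmul x y => simp
  have hh1 : ∀ a, h' (P1 (algebraMap _ _ a)) = m (h (tensorToCdil k e R n B (a ⊗ₜ 1))) :=
    fun a => by rw [hP1, canTA_eq, hh']
  have hh2 : ∀ a, h' (P2 (algebraMap _ _ a)) = m (h (tensorToCdil k e R n B (1 ⊗ₜ a))) :=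
    fun a => by rw [hP2, canTA_eq, hh']
  have hti' : (h' (P1 zi)).fst = ti := by
    have := congrArg TrivSqZeroExt.fst (congrArg (h'.comp P1) hzi)
    rw [map_mul, map_one, TrivSqZeroExt.fst_mul, RingHom.comp_apply, hh1, hm1, h1X] at this
    exact left_inv_eq_right_inv ((mul_comm _ _).trans this) hti
  have hsi' : (h' (P2 zi)).fst = si := by
    have := congrArg TrivSqZeroExt.fst (congrArg (h'.comp P2) hzi)
    rw [map_mul, map_one, TrivSqZeroExt.fst_mul, RingHom.comp_apply, hh2, hm1, h2X] at this
    refine left_inv_eq_right_inv ((mul_comm _ _).trans this) ?_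
    simpa using hsi
  have e1 := forms_hom_polar_eq _ ιR hιR lam κ (0 : T') ti (algebraMap _ Az Polynomial.X) zi
    (F'.comp Pull1)
    (fun a => by
      rw [RingHom.comp_apply, hPull1.1, hF', RingHom.comp_apply, hh1, hm1, h1C]; simp)
    (fun a => by
      rw [RingHom.comp_apply, hPull1.2, hFd', RingHom.comp_apply, hh1, hm2', h1C]; simp)
    (by rw [RingHom.comp_apply, hPull1.1, hF', hti'])
    (by rw [RingHom.comp_apply, hPull1.2, hFd', hh1, hm2', h1X]; simp) α β
  have e2 := forms_hom_polar_eq _ ιR hιR lam κ (J z ^ n) si (algebraMap _ Az Polynomial.X) zi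
    (F'.comp Pull2)
    (fun a => by
      rw [RingHom.comp_apply, hPull2.1, hF', RingHom.comp_apply, hh2, hm1, h2C]; simp)
    (fun a => by
      rw [RingHom.comp_apply, hPull2.2, hFd', RingHom.comp_apply, hh2, hm2', h2C]; simp)
    (by rw [RingHom.comp_apply, hPull2.1, hF', hsi'])
    (by rw [RingHom.comp_apply, hPull2.2, hFd', hh2, hm2', h2X]; simp) α β
  rw [RingHom.comp_apply] at e1 e2
  have e3 := congrArg F' hω
  rw [map_sub, e1, e2, hcomp] at e3
  let Λ := (TensorProduct.lid R (Matrix (Fin 2) (Fin 2)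
    (ExteriorAlgebra R (KaehlerDifferential k R)))).toLinearMap ∘ₗ LinearMap.rTensor _ μ
  have hΛ : ∀ t x, Λ (t ⊗ₜ x) = μ t • x := fun t x => by simp [Λ]
  have h0 : Λ (Algebra.TensorProduct.map J (AlgHom.id R _) (F ω)) = 0 := by
    generalize F ω = x
    induction x with
    | zero => simp
    | add x y hx hy => rw [map_add, map_add, hx, hy, add_zero]
    | tmul x y => rw [Algebra.TensorProduct.map_tmul, hΛ, hμ, zero_smul]
  have e4 := congrArg Λ e3
  simp only [h0, map_sub, map_add, map_sum, hΛ, mul_zero, map_zero, zero_smul, add_zero,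
    Finset.sum_const_zero, zero_add] at e4
  refine ⟨?_, ?_⟩
  · have e5 := congrFun (congrFun e4 0) 1
    simp [formsBlock, Matrix.sum_apply] at e5
    exact e5.symm
  · have e5 := congrFun (congrFun e4 1) 1
    simp [formsBlock, Matrix.sum_apply] at e5
    simp only [sub_smul, Finset.sum_sub_distrib]
    exact e5.symm

end PolarVanishing

section PoleOrder

/-- The coefficient of `T ^ m`, as a linear map. -/
def laurentCoeff (R : Type) [CommRing R] (m : ℤ) : LaurentPolynomial R →ₗ[R] R where
  toFun f := f.coeff m
  map_add' _ _ := rfl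
  map_smul' _ _ := rfl

theorem laurentCoeff_T {R : Type} [CommRing R] (m i : ℤ) :
    laurentCoeff R m (LaurentPolynomial.T i) = if i = m then 1 else 0 :=
  LaurentPolynomial.T_apply _ _

theorem laurentCoeff_toLaurent {R : Type} [CommRing R] {m : ℤ} (hm : m < 0) (f : Polynomial R) :
    laurentCoeff R m (Polynomial.toLaurent f) = 0 := by
  change (Polynomial.toLaurent f).coeff m = 0
  rw [← Finsupp.notMem_support_iff, LaurentPolynomial.support_coeff_toLaurent]
  simp only [Finset.mem_map, not_exists, not_and]
  rintro i - rfl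
  exact absurd hm (not_lt.2 (Int.natCast_nonneg i))

variable {k} {R : Type} [CommRing R] [Algebra k R] {n q r : ℕ}
  {α : Fin q → ExteriorAlgebra R (KaehlerDifferential k R)}
  {β : Fin r → ExteriorAlgebra R (KaehlerDifferential k R)}

theorem PolarVanishing.laurent (hv : PolarVanishing k n α β) {m : ℤ} (hm : m < 0)
    (lam : Module.Dual R (KaehlerDifferential k R)) (κ : R) :
    (∑ i : Fin q, (if (n : ℤ) - ((i : ℕ) + 1) = m then (1 : R) else 0) • (κ •
        CliffordAlgebra.involute (Q := (0 : QuadraticForm R (KaehlerDifferential k R))) (α i))) +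
      ∑ i : Fin r, (if (n : ℤ) - ((i : ℕ) + 1) = m then (1 : R) else 0) •
        CliffordAlgebra.contractLeft
          (Q := (0 : QuadraticForm R (KaehlerDifferential k R))) lam (β i) = 0 := by
  have hT : Polynomial.toLaurentAlg (Polynomial.X : Polynomial R) * LaurentPolynomial.T (-1) = 1 := by
    rw [Polynomial.toLaurentAlg_apply, Polynomial.toLaurent_X, ← LaurentPolynomial.T_add]
    exact LaurentPolynomial.T_zero
  have h := (hv (Polynomial R) (LaurentPolynomial R) Polynomial.toLaurentAlg (RingHom.id _)
    (fun _ => rfl) Polynomial.X 0 rfl rfl lam κ (LaurentPolynomial.T (-1))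
    (LaurentPolynomial.T (-1)) hT (by rw [mul_zero, add_zero, hT]) (laurentCoeff R m)
    (fun f => laurentCoeff_toLaurent hm f)).1
  have h2 : ∀ i : ℕ, laurentCoeff R m (LaurentPolynomial.T (-1) ^ (i + 1) *
      Polynomial.toLaurentAlg (Polynomial.X : Polynomial R) ^ n) =
      if (n : ℤ) - ((i : ℕ) + 1) = m then (1 : R) else 0 := fun i => by
    rw [Polynomial.toLaurentAlg_apply, Polynomial.toLaurent_X, LaurentPolynomial.T_pow,
      LaurentPolynomial.T_pow, ← LaurentPolynomial.T_add, laurentCoeff_T]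
    congr 1
    push_cast
    rw [eq_iff_iff]
    constructor <;> intro h <;> linarith
  simpa only [h2] using h

theorem PolarVanishing.dz_pole_le (hv : PolarVanishing k n α β) (hq : 1 ≤ q)
    (hα : α ⟨q - 1, Nat.sub_lt hq Nat.one_pos⟩ ≠ 0) : q ≤ n := by
  by_contra hlt
  have h := hv.laurent (m := n - q) (by omega) 0 1
  rw [Finset.sum_eq_single (⟨q - 1, Nat.sub_lt hq Nat.one_pos⟩ : Fin q)
    (fun i _ hi => by
      rw [if_neg, zero_smul]
      intro h
      exact hi (Fin.ext (by simp only; omega))) (by simp), if_pos (by simp only; omega),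
    one_smul, one_smul] at h
  simp only [map_zero, LinearMap.zero_apply, smul_zero, Finset.sum_const_zero, add_zero] at h
  refine hα ?_
  have := congrArg (CliffordAlgebra.involute
    (Q := (0 : QuadraticForm R (KaehlerDifferential k R)))) h
  rwa [CliffordAlgebra.involute_involute, map_zero] at this

theorem PolarVanishing.pole_le (hv : PolarVanishing k n α β) (hr : 1 ≤ r)
    {ι : Type} [Fintype ι] (b : Module.Basis ι R (KaehlerDifferential k R)) {j : ℕ} (hj : 1 ≤ j)
    (hβj : ∀ i, β i ∈ OmegaPow k R j)
    (hβ : β ⟨r - 1, Nat.sub_lt hr Nat.one_pos⟩ ≠ 0) : r ≤ n := by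
  by_contra hlt
  refine hβ (eq_zero_of_contractLeft b hj (hβj _) fun i => ?_)
  have h := hv.laurent (m := n - r) (by omega) (b.coord i) 0
  rw [add_comm, Finset.sum_eq_single (⟨r - 1, Nat.sub_lt hr Nat.one_pos⟩ : Fin r)
    (fun i _ hi => by
      rw [if_neg, zero_smul]
      intro h
      exact hi (Fin.ext (by simp only; omega))) (by simp), if_pos (by simp only; omega),
    one_smul] at h
  simpa using h

theorem PolarVanishing.natCast_smul_eq_zero (hv : PolarVanishing k n α β) (hr : 1 ≤ r) (hn : n ≤ r) :
    (r : R) • β ⟨r - 1, Nat.sub_lt hr Nat.one_pos⟩ = 0 := by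
  obtain ⟨g, hg1, hg2⟩ := exists_trivSqZeroExt_map
    (Polynomial.toLaurent : Polynomial R →+* LaurentPolynomial R)
    (Polynomial.toLaurent : Polynomial R →+* LaurentPolynomial R).toAddMonoidHom
    (fun a b => map_mul (Polynomial.toLaurent : Polynomial R →+* LaurentPolynomial R) a b)
  have hg : ∀ a : R, g (algebraMap R _ a) = algebraMap R _ a := fun a => by
    refine TrivSqZeroExt.ext ?_ ?_
    · rw [hg1]
      exact Polynomial.toLaurent_C a
    · rw [hg2]
      exact map_zero (Polynomial.toLaurent : Polynomial R →+* LaurentPolynomial R)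
  let J : TrivSqZeroExt (Polynomial R) (Polynomial R) →ₐ[R]
      TrivSqZeroExt (LaurentPolynomial R) (LaurentPolynomial R) := { g with commutes' := hg }
  have hJ1 : ∀ x, (J x).fst = Polynomial.toLaurent x.fst := hg1
  have hJ2 : ∀ x, (J x).snd = Polynomial.toLaurent x.snd := hg2
  let π : TrivSqZeroExt (Polynomial R) (Polynomial R) →+* Polynomial R :=
    { toFun := TrivSqZeroExt.fst, map_one' := rfl, map_mul' := fun _ _ => rfl, map_zero' := rfl,
      map_add' := fun _ _ => rfl }
  have _ : IsLocalHom π := ⟨fun x hx => TrivSqZeroExt.isUnit_iff_isUnit_fst.2 hx⟩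
  let μ : TrivSqZeroExt (LaurentPolynomial R) (LaurentPolynomial R) →ₗ[R] R :=
    { toFun := fun x => laurentCoeff R (n - 1 - r) x.snd
      map_add' := fun x y => by rw [TrivSqZeroExt.snd_add, map_add]
      map_smul' := fun a x => by rw [TrivSqZeroExt.snd_smul, map_smul, RingHom.id_apply] }
  have hμ : ∀ x, μ x = laurentCoeff R (n - 1 - r) x.snd := fun _ => rfl
  have hT (i j : ℤ) : (LaurentPolynomial.T i : LaurentPolynomial R) * LaurentPolynomial.T j =
      LaurentPolynomial.T (i + j) := (LaurentPolynomial.T_add i j).symm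
  let ti : TrivSqZeroExt (LaurentPolynomial R) (LaurentPolynomial R) :=
    TrivSqZeroExt.inl (LaurentPolynomial.T (-1))
  let si : TrivSqZeroExt (LaurentPolynomial R) (LaurentPolynomial R) :=
    ti - TrivSqZeroExt.inr (LaurentPolynomial.T (n - 2))
  have hsi1 : si.fst = LaurentPolynomial.T (-1) := by simp [si, ti]
  have hsi2 : si.snd = -LaurentPolynomial.T (n - 2) := by simp [si, ti]
  have hti : J (TrivSqZeroExt.inl Polynomial.X) * ti = 1 := by
    refine TrivSqZeroExt.ext ?_ ?_
    · simp [hJ1, ti, hT]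
    · simp [hJ1, hJ2, ti]
  have hsi : J (TrivSqZeroExt.inl Polynomial.X +
      TrivSqZeroExt.inl Polynomial.X ^ n * TrivSqZeroExt.inr 1) * si = 1 := by
    refine TrivSqZeroExt.ext ?_ ?_
    · simp [hJ1, hsi1, hT]
    · rw [TrivSqZeroExt.snd_mul, hJ1, hJ2, hsi1, hsi2]
      simp [hT]
      ring_nf
  have h := (hv _ _ J π (fun _ => rfl) (TrivSqZeroExt.inl Polynomial.X) (TrivSqZeroExt.inr 1) rfl
    rfl 0 0 ti si hti hsi μ (fun f => by rw [hμ, hJ2, laurentCoeff_toLaurent (by omega)])).2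
  have h1 : ∀ i : ℕ, μ (si ^ (i + 1)) = if i + 1 = r then -(r : R) else 0 := fun i => by
    rw [hμ, TrivSqZeroExt.snd_pow, hsi1, hsi2]
    rw [LaurentPolynomial.T_pow, smul_neg, smul_eq_mul, hT, smul_neg, map_neg, map_nsmul,
      laurentCoeff_T, Nat.pred_succ, nsmul_eq_mul]
    by_cases hi : i + 1 = r
    · rw [if_pos hi, if_pos (by subst hi; push_cast; ring), hi, mul_one]
    · rw [if_neg hi, if_neg (by omega), mul_zero, neg_zero]
  have h2 : ∀ i : ℕ, μ (ti ^ (i + 1)) = 0 := fun i => by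
    rw [hμ, TrivSqZeroExt.inl_pow, TrivSqZeroExt.snd_inl, map_zero]
  simp only [h1, h2] at h
  rw [Finset.sum_eq_single (⟨r - 1, Nat.sub_lt hr Nat.one_pos⟩ : Fin r)
    (fun i _ hi => by
      rw [if_neg, sub_zero, zero_smul]
      intro h
      exact hi (Fin.ext (by simp only; omega))) (by simp), if_pos (by simp only; omega),
    sub_zero, neg_smul, neg_eq_zero] at h
  exact h

end PoleOrder

/-- The basis `d z_i` of the differentials of an étale algebra over `k[z₁, …, z_e]`. -/
def kaehlerBasisOfFormallyEtale (e : ℕ) (R : Type) [CommRing R] [Algebra k R]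
    [Algebra (MvPolynomial (Fin e) k) R] [IsScalarTower k (MvPolynomial (Fin e) k) R]
    [Algebra.FormallyEtale (MvPolynomial (Fin e) k) R] :
    Module.Basis (Fin e) R (KaehlerDifferential k R) :=
  ((KaehlerDifferential.mvPolynomialBasis k (Fin e)).baseChange R).map
    (KaehlerDifferential.tensorKaehlerEquivOfFormallyEtale k (MvPolynomial (Fin e) k) R)

section Extension

variable {k} {e : ℕ} {R : Type} [CommRing R] [Algebra k R] [Algebra (MvPolynomial (Fin e) k) R]
  {B : Type} [CommRing B] [Algebra (PolyA R ⊗[k] PolyA R) B]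

/-- On the dilatation ring the two projections agree modulo `t ^ n`. -/
theorem exists_tensorToCdil_sub_eq (Θ : Fin (e + 1) → B)
    (hΘ0 : Θ 0 = algebraMap (PolyA R ⊗[k] PolyA R) B (sElt k R - tElt k R))
    (hΘs : ∀ i : Fin e, Θ i.succ = algebraMap (PolyA R ⊗[k] PolyA R) B (θElt k e R i))
    (hgen : Ideal.map (algebraMap (PolyA R ⊗[k] PolyA R) B)
        (KaehlerDifferential.ideal k (PolyA R)) = Ideal.span (Set.range Θ))
    (n : ℕ) (a : PolyA R) :
    ∃ x, tensorToCdil k e R n B ((1 : PolyA R) ⊗ₜ[k] a) -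
      tensorToCdil k e R n B (a ⊗ₜ[k] (1 : PolyA R)) = tC k e R n B ^ n * x := by
  have hle : Ideal.map (algebraMap (PolyA R ⊗[k] PolyA R) B)
      (KaehlerDifferential.ideal k (PolyA R)) ≤
      (Ideal.span {tC k e R n B ^ n}).comap ((mvToCdil k e R n B).comp MvPolynomial.C) := by
    rw [hgen, Ideal.span_le]
    rintro _ ⟨i, rfl⟩
    rw [SetLike.mem_coe, Ideal.mem_comap, Ideal.mem_span_singleton, RingHom.comp_apply]
    refine Fin.cases ?_ (fun i => ?_) i
    · rw [hΘ0, mvToCdil_rel_zero]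
      exact dvd_mul_left _ _
    · rw [hΘs, mvToCdil_rel_succ]
      exact dvd_mul_left _ _
  have := hle (Ideal.mem_map_of_mem _
    (KaehlerDifferential.one_smul_sub_smul_one_mem_ideal k a))
  rw [Ideal.mem_comap, Ideal.mem_span_singleton, map_sub, map_sub] at this
  exact this

/-- The difference of the two pullbacks of a polar form of small pole order extends to `C`. -/
theorem exists_extension_of_pole_le [Algebra k B] [IsScalarTower k (PolyA R ⊗[k] PolyA R) B]
    (Θ : Fin (e + 1) → B)
    (hΘ0 : Θ 0 = algebraMap (PolyA R ⊗[k] PolyA R) B (sElt k R - tElt k R))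
    (hΘs : ∀ i : Fin e, Θ i.succ = algebraMap (PolyA R ⊗[k] PolyA R) B (θElt k e R i))
    (hgen : Ideal.map (algebraMap (PolyA R ⊗[k] PolyA R) B)
        (KaehlerDifferential.ideal k (PolyA R)) = Ideal.span (Set.range Θ))
    {n : ℕ} (hn : 1 ≤ n) {Az : Type} [CommRing Az] [Algebra (PolyA R) Az] [Algebra k Az]
    {Ct : Type} [CommRing Ct] [Algebra (Cdil k e R n B) Ct] [Algebra k Ct]
    {zi : Az} (hzi : algebraMap (PolyA R) Az Polynomial.X * zi = 1)
    {P1 P2 : Az →+* Ct}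
    (hP1 : ∀ a : PolyA R, P1 (algebraMap (PolyA R) Az a) =
      canTA k e R n B Ct (a ⊗ₜ[k] (1 : PolyA R)))
    (hP2 : ∀ a : PolyA R, P2 (algebraMap (PolyA R) Az a) =
      canTA k e R n B Ct ((1 : PolyA R) ⊗ₜ[k] a))
    {Pull1 Pull2 : ExteriorAlgebra Az (KaehlerDifferential k Az) →+*
      ExteriorAlgebra Ct (KaehlerDifferential k Ct)}
    (hPull1 : IsPullback k Az Ct P1 Pull1)
    (hPull2 : IsPullback k Az Ct P2 Pull2)
    {ιR : ExteriorAlgebra R (KaehlerDifferential k R) →+*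
      ExteriorAlgebra Az (KaehlerDifferential k Az)}
    (hιR : IsPullback k R Az
      ((algebraMap (PolyA R) Az).comp (Polynomial.C : R →+* PolyA R)) ιR)
    {cstar : ExteriorAlgebra (Cdil k e R n B) (KaehlerDifferential k (Cdil k e R n B)) →+*
      ExteriorAlgebra Ct (KaehlerDifferential k Ct)}
    (hcstar : IsPullback k (Cdil k e R n B) Ct
      (algebraMap (Cdil k e R n B) Ct) cstar)
    {j : ℕ} (hj : 1 ≤ j) {q r : ℕ} (hq : q ≤ n)
    (hr : r ≤ n - 1 ∨ ((n : k) = 0 ∧ 2 ≤ n ∧ r ≤ n))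
    {α : Fin q → ExteriorAlgebra R (KaehlerDifferential k R)}
    (hα : ∀ i, α i ∈ OmegaPow k R (j - 1))
    {β : Fin r → ExteriorAlgebra R (KaehlerDifferential k R)}
    (hβ : ∀ i, β i ∈ OmegaPow k R j) :
    ∃ ω, ω ∈ OmegaPow k (Cdil k e R n B) j ∧
      cstar ω =
        Pull2 ((∑ i : Fin q, ιR (α i) *
            ((zi ^ ((i : ℕ) + 1)) • dE k Az (algebraMap (PolyA R) Az Polynomial.X))) +
          ∑ i : Fin r, (zi ^ ((i : ℕ) + 1)) • ιR (β i)) -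
        Pull1 ((∑ i : Fin q, ιR (α i) *
            ((zi ^ ((i : ℕ) + 1)) • dE k Az (algebraMap (PolyA R) Az Polynomial.X))) +
          ∑ i : Fin r, (zi ^ ((i : ℕ) + 1)) • ιR (β i)) := by
  let T := tensorToCdil k e R n B
  let φ₁ : R →+* Cdil k e R n B := (T.comp (Algebra.TensorProduct.includeLeftRingHom)).comp Polynomial.C
  let φ₂ : R →+* Cdil k e R n B := (T.comp
    (Algebra.TensorProduct.includeRight : PolyA R →ₐ[k] PolyA R ⊗[k] PolyA R).toRingHom).comp
      Polynomial.C
  have hφ₁ : ∀ c : k, φ₁ (algebraMap k R c) = algebraMap k (Cdil k e R n B) c := fun c =>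
    (algebraMap_Cdil_eq k e R n B c).symm
  have hφ₂ : ∀ c : k, φ₂ (algebraMap k R c) = algebraMap k (Cdil k e R n B) c := fun c => by
    rw [algebraMap_Cdil_eq]
    exact congrArg T
      ((Algebra.TensorProduct.includeRight : PolyA R →ₐ[k] PolyA R ⊗[k] PolyA R).commutes c)
  have hs : T (sElt k R) = tC k e R n B + tC k e R n B ^ n * mvToCdil k e R n B (.X 0) := by
    have h := mvToCdil_rel_zero k e R n B
    rw [← tensorToCdil_C, map_sub, ← tC_eq, sub_eq_iff_eq_add'] at h
    rw [mul_comm (tC k e R n B ^ n)]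
    exact h
  obtain ⟨w, hw⟩ := (isUnit_one_add_tau k e R n B).exists_left_inv
  have hz1 : P1 (algebraMap (PolyA R) Az Polynomial.X) = algebraMap (Cdil k e R n B) Ct (tC k e R n B) :=
    hP1 _
  have hz2 : P2 (algebraMap (PolyA R) Az Polynomial.X) = algebraMap (Cdil k e R n B) Ct
      (tC k e R n B + tC k e R n B ^ n * mvToCdil k e R n B (.X 0)) := by
    rw [← hs]
    exact hP2 _
  have hG₁ : IsPullback k R Ct ((algebraMap (Cdil k e R n B) Ct).comp φ₁) (Pull1.comp ιR) := by
    convert hιR.comp hPull1 using 1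
    ext a
    exact (hP1 _).symm
  have hG₂ : IsPullback k R Ct ((algebraMap (Cdil k e R n B) Ct).comp φ₂) (Pull2.comp ιR) := by
    convert hιR.comp hPull2 using 1
    ext a
    exact (hP2 _).symm
  have hnC : (n : k) = 0 → (n : Cdil k e R n B) = 0 := fun h => by
    rw [← map_natCast (algebraMap k (Cdil k e R n B)), h, map_zero]
  obtain ⟨ω, hω⟩ := exists_pullback_eq_sub hφ₁ hφ₂ (tC k e R n B)
    (mvToCdil k e R n B (.X 0)) w
    (fun a => exists_tensorToCdil_sub_eq Θ hΘ0 hΘs hgen n (Polynomial.C a)) hn hw hcstar hG₁ hG₂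
    (P1 zi) (P2 zi) (by rw [← hz1, ← map_mul, hzi, map_one])
    (by rw [← hz2, ← map_mul, hzi, map_one]) hq (hr.imp_right fun h => ⟨hnC h.1, h.2⟩) α β
  set φ := (∑ i : Fin q, ιR (α i) *
            ((zi ^ ((i : ℕ) + 1)) • dE k Az (algebraMap (PolyA R) Az Polynomial.X))) +
          ∑ i : Fin r, (zi ^ ((i : ℕ) + 1)) • ιR (β i) with hφ
  have hmem : φ ∈ OmegaPow k Az j := by
    refine add_mem (sum_mem fun i _ => ?_) (sum_mem fun i _ => ?_)
    · rw [mul_smul_comm]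
      have := mul_dE_mem_OmegaPow (hιR.map_OmegaPow (hα i))
        (algebraMap (PolyA R) Az Polynomial.X)
      rw [Nat.sub_add_cancel hj] at this
      exact Submodule.smul_mem _ _ this
    · exact Submodule.smul_mem _ _ (hιR.map_OmegaPow (hβ i))
  have hω' : cstar ω = Pull2 φ - Pull1 φ := by
    rw [hω, hφ, ← hz1, ← hz2]
    simp only [map_add, map_sum, map_mul, hPull1.map_smul, hPull2.map_smul, map_pow, hPull1.2,
      hPull2.2, RingHom.comp_apply]
  have hmem' : cstar ω ∈ OmegaPow k Ct j :=
    hω' ▸ sub_mem (hPull2.map_OmegaPow hmem) (hPull1.map_OmegaPow hmem)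
  obtain ⟨y, hy, hy'⟩ := hcstar.exists_mem_OmegaPow hmem'
  exact ⟨y, hy, hy'.trans hω'⟩

end Extension

/-!
STATEMENT 5.
Let `k` be a perfect field of characteristic `p ≥ 0`, `d = e + 1 ≥ 1`, and
`k[z₁, …, z_{d-1}] → R` an étale ring homomorphism (étale = formally étale and of finite
presentation; for `d = 1`, i.e. `e = 0`, this says `R` is étale over `k`).  Let `A = R[z]`
and, in `A ⊗_k A`, set `t = z⊗1`, `s = 1⊗z`, `t_i = z_i⊗1`, `s_i = 1⊗z_i`,
`θ_i = s_i − t_i`.  Let `S ⊆ A ⊗_k A` be a multiplicative set with `μ(S) ⊆ A^×`,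
`B = S^{-1}(A ⊗_k A)`, and assume the diagonal ideal of `B` is generated by the regular
sequence `s−t, θ₁, …, θ_{d-1}`.  For `n ≥ 1` let
`C = B[τ, τ₁,…,τ_{d-1}][(1+t^{n-1}τ)^{-1}]/(s−t−t^nτ, θ₁−t^nτ₁, …, θ_{d-1}−t^nτ_{d-1})`.
Let `j ≥ 1`, `q, r ≥ 1`, `α₁, …, α_q ∈ Ω^{j-1}_R` with `α_q ≠ 0`, and
`β₁, …, β_r ∈ Ω^j_R` with `β_r ≠ 0`, and set
`φ = Σ_{i=1}^q ι(α_i) ∧ (z^{-i}·dz) + Σ_{i=1}^r z^{-i}·ι(β_i) ∈ Ω^j_{A[1/z]}`,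
where `ι` is induced by `R → A[1/z]`.  Then `p₂^*(φ) − p₁^*(φ) ∈ Ω^j_{C[1/t]}` lies in the
image of the canonical map `Ω^j_C → Ω^j_{C[1/t]}` if and only if: (`q ≤ n` and `r ≤ n−1`)
in case `p = 0` or `p` does not divide `n`; and (`q ≤ n` and `r ≤ n`) in case `p > 0` and
`p` divides `n`.

Formalization notes: `Ω^j` is the degree-`j` part of the exterior algebra of Kähler
differentials (`OmegaPow`); `z^{-1}` is the element `zi` of `A[1/z]` with `z·zi = 1`; the
ring homomorphisms `p₁, p₂ : A[1/z] → C[1/t]` are characterized by their values on `A`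
(via the canonical map `A ⊗_k A → C[1/t]` and `a ↦ a⊗1` resp. `a ↦ 1⊗a`), and the induced
maps on forms (`Pull1`, `Pull2`, `ιR` for `R → A[1/z]`, and `cstar` for `C → C[1/t]`) are
characterized by `IsPullback`.
-/
theorem stmt5 [PerfectField k] (p : ℕ) (hp : CharP k p)
    (e : ℕ) (R : Type) [CommRing R] [Algebra k R]
    [Algebra (MvPolynomial (Fin e) k) R] [IsScalarTower k (MvPolynomial (Fin e) k) R]
    [Algebra.FormallyEtale (MvPolynomial (Fin e) k) R]
    [Algebra.FinitePresentation (MvPolynomial (Fin e) k) R]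
    (M : Submonoid (PolyA R ⊗[k] PolyA R))
    (hM : ∀ x ∈ M,
      IsUnit ((Algebra.TensorProduct.lmul' k (S := PolyA R) :
        PolyA R ⊗[k] PolyA R →ₐ[k] PolyA R) x))
    (B : Type) [CommRing B] [Algebra (PolyA R ⊗[k] PolyA R) B] [IsLocalization M B]
    [Algebra k B] [IsScalarTower k (PolyA R ⊗[k] PolyA R) B]
    (Θ : Fin (e + 1) → B)
    (hΘ0 : Θ 0 = algebraMap (PolyA R ⊗[k] PolyA R) B (sElt k R - tElt k R))
    (hΘs : ∀ i : Fin e, Θ i.succ = algebraMap (PolyA R ⊗[k] PolyA R) B (θElt k e R i))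
    (hreg : IsRegSeq Θ)
    (hgen : Ideal.map (algebraMap (PolyA R ⊗[k] PolyA R) B)
        (KaehlerDifferential.ideal k (PolyA R)) = Ideal.span (Set.range Θ))
    (n : ℕ) (hn : 1 ≤ n)
    (Az : Type) [CommRing Az] [Algebra (PolyA R) Az]
    [IsLocalization.Away (Polynomial.X : PolyA R) Az]
    [Algebra k Az] [IsScalarTower k (PolyA R) Az]
    (Ct : Type) [CommRing Ct] [Algebra (Cdil k e R n B) Ct]
    [IsLocalization.Away (tC k e R n B) Ct]
    [Algebra k Ct] [IsScalarTower k (Cdil k e R n B) Ct]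
    (zi : Az) (hzi : algebraMap (PolyA R) Az Polynomial.X * zi = 1)
    (P1 P2 : Az →+* Ct)
    (hP1 : ∀ a : PolyA R, P1 (algebraMap (PolyA R) Az a) =
      canTA k e R n B Ct (a ⊗ₜ[k] (1 : PolyA R)))
    (hP2 : ∀ a : PolyA R, P2 (algebraMap (PolyA R) Az a) =
      canTA k e R n B Ct ((1 : PolyA R) ⊗ₜ[k] a))
    (Pull1 Pull2 : ExteriorAlgebra Az (KaehlerDifferential k Az) →+*
      ExteriorAlgebra Ct (KaehlerDifferential k Ct))
    (hPull1 : IsPullback k Az Ct P1 Pull1)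
    (hPull2 : IsPullback k Az Ct P2 Pull2)
    (ιR : ExteriorAlgebra R (KaehlerDifferential k R) →+*
      ExteriorAlgebra Az (KaehlerDifferential k Az))
    (hιR : IsPullback k R Az
      ((algebraMap (PolyA R) Az).comp (Polynomial.C : R →+* PolyA R)) ιR)
    (cstar : ExteriorAlgebra (Cdil k e R n B) (KaehlerDifferential k (Cdil k e R n B)) →+*
      ExteriorAlgebra Ct (KaehlerDifferential k Ct))
    (hcstar : IsPullback k (Cdil k e R n B) Ct
      (algebraMap (Cdil k e R n B) Ct) cstar)
    (j : ℕ) (hj : 1 ≤ j) (q r : ℕ) (hq : 1 ≤ q) (hr : 1 ≤ r)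
    (α : Fin q → ExteriorAlgebra R (KaehlerDifferential k R))
    (hα : ∀ i, α i ∈ OmegaPow k R (j - 1))
    (hαq : α ⟨q - 1, Nat.sub_lt hq Nat.one_pos⟩ ≠ 0)
    (β : Fin r → ExteriorAlgebra R (KaehlerDifferential k R))
    (hβ : ∀ i, β i ∈ OmegaPow k R j)
    (hβr : β ⟨r - 1, Nat.sub_lt hr Nat.one_pos⟩ ≠ 0) :
    (∃ ω, ω ∈ OmegaPow k (Cdil k e R n B) j ∧
      cstar ω =
        Pull2 ((∑ i : Fin q, ιR (α i) *
            ((zi ^ ((i : ℕ) + 1)) • dE k Az (algebraMap (PolyA R) Az Polynomial.X))) +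
          ∑ i : Fin r, (zi ^ ((i : ℕ) + 1)) • ιR (β i)) -
        Pull1 ((∑ i : Fin q, ιR (α i) *
            ((zi ^ ((i : ℕ) + 1)) • dE k Az (algebraMap (PolyA R) Az Polynomial.X))) +
          ∑ i : Fin r, (zi ^ ((i : ℕ) + 1)) • ιR (β i))) ↔
    (((p = 0 ∨ ¬ p ∣ n) ∧ q ≤ n ∧ r ≤ n - 1) ∨
      ((p ≠ 0 ∧ p ∣ n) ∧ q ≤ n ∧ r ≤ n)) := by
  constructor
  · rintro ⟨ω, -, hω⟩
    have hv := polar_vanishing M hM B n Az Ct zi hzi P1 P2 hP1 hP2 Pull1 Pull2 hPull1 hPull2 ιR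
      hιR cstar hcstar hω
    have hqn := hv.dz_pole_le hq hαq
    have hrn := hv.pole_le hr (kaehlerBasisOfFormallyEtale k e R) hj hβ hβr
    by_cases hpn : p ≠ 0 ∧ p ∣ n
    · exact Or.inr ⟨hpn, hqn, hrn⟩
    refine Or.inl ⟨by tauto, hqn, Nat.le_sub_one_of_lt (lt_of_le_of_ne hrn ?_)⟩
    rintro rfl
    have hnk : (r : k) ≠ 0 := fun h => by
      have hdvd := (CharP.cast_eq_zero_iff k p r).1 h
      exact hpn ⟨fun hp0 => by subst hp0; omega, hdvd⟩
    have h := hv.natCast_smul_eq_zero hr le_rfl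
    have hu : IsUnit (r : R) := by
      rw [← map_natCast (algebraMap k R)]
      exact (IsUnit.mk0 _ hnk).map _
    exact hβr ((hu.smul_eq_zero).1 h)
  · rintro (⟨-, hqn, hrn⟩ | ⟨⟨hp0, hpn⟩, hqn, hrn⟩)
    · exact exists_extension_of_pole_le Θ hΘ0 hΘs hgen hn hzi hP1 hP2 hPull1 hPull2 hιR hcstar hj
        hqn (Or.inl hrn) hα hβ
    · have hp2 := ((CharP.char_is_prime_or_zero k p).resolve_right hp0).two_le
      exact exists_extension_of_pole_le Θ hΘ0 hΘs hgen hn hzi hP1 hP2 hPull1 hPull2 hιR hcstar hj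
        hqn (Or.inr ⟨(CharP.cast_eq_zero_iff k p n).2 hpn, hp2.trans (Nat.le_of_dvd hn hpn), hrn⟩)
        hα hβ
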